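/- Let M be a σ-compact, non-compact, connected 2-manifold with boundary. If ∂M has at least two distinct connected components homeomorphic to the circle S¹, then the mapping class group 𝓜_c(M) = 𝓗_c(M)/𝓗₀(M) contains an element of infinite order. -/

import Mathlib

noncomputable section

open scoped Pointwise

/-- The Whitney topology on the homeomorphism group of a space `M`:
it is generated by the sets `{f | graph f ⊆ U}` where `U` runs over the open subsets
of `M × M`. -/
def whitneyTopology (M : Type*) [TopologicalSpace M] : TopologicalSpace (M ≃ₜ M) :=
  TopologicalSpace.generateFrom
    {S : Set (M ≃ₜ M) | ∃ U : Set (M × M), IsOpen U ∧ S = {f : M ≃ₜ M | ∀ x : M, (x, f x) ∈ U}}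

/-- We endow the homeomorphism group `𝓗(M)` with the Whitney topology. -/
instance (M : Type*) [TopologicalSpace M] : TopologicalSpace (M ≃ₜ M) := whitneyTopology M

/-- `𝓗_c(M)`: the set of compactly supported homeomorphisms of `M`. -/
def Hc (M : Type*) [TopologicalSpace M] : Set (M ≃ₜ M) :=
  {f : M ≃ₜ M | IsCompact (closure {x : M | f x ≠ x})}

/-- `𝓗₀(M)`: the identity component of the homeomorphism group of `M` with
the Whitney topology. -/
def H0 (M : Type*) [TopologicalSpace M] : Set (M ≃ₜ M) :=
  connectedComponent (Homeomorph.refl M)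

/-- The `n`-th power (iterate) of a self-homeomorphism. -/
def hpow {M : Type*} [TopologicalSpace M] (h : M ≃ₜ M) : ℕ → (M ≃ₜ M)
  | 0 => Homeomorph.refl M
  | n + 1 => (hpow h n).trans h

/-- The circle `S¹`. -/
abbrev Circle2 : Type := ↥(Metric.sphere (0 : EuclideanSpace ℝ (Fin 2)) 1)

/-- The boundary `∂M` of a 2-manifold `M` modelled on the half-plane. -/
abbrev surfaceBoundary (M : Type*) [TopologicalSpace M]
    [ChartedSpace (EuclideanHalfSpace 2) M] : Set M :=
  ModelWithCorners.boundary (I := modelWithCornersEuclideanHalfSpace 2) M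

section

open Set Filter Topology

section

/-- A nowhere vanishing continuous function on a contractible space has a continuous logarithm. -/
theorem exists_continuous_log {A : Type*} [TopologicalSpace A] [ContractibleSpace A]
    (F : A → ℂ) (hF : Continuous F) (h0 : ∀ a, F a ≠ 0) :
    ∃ L : A → ℂ, Continuous L ∧ ∀ a, Complex.exp (L a) = F a := by
  obtain ⟨p, ⟨H⟩⟩ := id_nullhomotopic A
  let K : C(unitInterval × A, {z : ℂ // z ≠ 0}) :=
    ⟨fun x => ⟨F (H.symm x), h0 _⟩, by fun_prop⟩
  let f : C(A, ℂ) := ContinuousMap.const A (Complex.log (F p))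
  have hK : ∀ a, K (0, a) = (⟨_, Complex.exp_ne_zero (f a)⟩ : {z : ℂ // z ≠ 0}) := by
    intro a
    apply Subtype.ext
    simp [K, f, Complex.exp_log (h0 p)]
  refine ⟨fun a => Complex.isCoveringMap_exp.liftHomotopy K f hK (1, a), by fun_prop, fun a => ?_⟩
  have := congr_fun (Complex.isCoveringMap_exp.liftHomotopy_lifts K f hK) (1, a)
  have h2 := congr_arg Subtype.val this
  simpa [K] using h2

/-- Two continuous functions on a preconnected space with equal exponentials differ by a
constant. -/
theorem eqOn_sub_of_exp_eq {A : Type*} [TopologicalSpace A] {s : Set A} (hs : IsPreconnected s)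
    {L L' : A → ℂ} (hL : ContinuousOn L s) (hL' : ContinuousOn L' s)
    (h : ∀ a ∈ s, Complex.exp (L a) = Complex.exp (L' a)) {a b : A} (ha : a ∈ s) (hb : b ∈ s) :
    L a - L' a = L b - L' b := by
  set f : A → ℂ := fun a => (L a - L' a) / (2 * Real.pi * Complex.I) with hf
  have hfc : ContinuousOn f s := (hL.sub hL').div_const _
  have key : ∀ a ∈ s, ∃ n : ℤ, f a = n := by
    intro a ha
    obtain ⟨n, hn⟩ := Complex.exp_eq_exp_iff_exists_int.1 (h a ha)
    refine ⟨n, ?_⟩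
    simp only [hf, hn]
    have := Complex.two_pi_I_ne_zero
    field_simp
    ring
  have him : IsPreconnected (f '' s) := hs.image f hfc
  have hre : IsPreconnected ((fun z : ℂ => z.re) '' (f '' s)) :=
    him.image _ Complex.continuous_re.continuousOn
  have hsub : ((fun z : ℂ => z.re) '' (f '' s)).Subsingleton := by
    have hZ : ((fun z : ℂ => z.re) '' (f '' s)) ⊆ range ((↑) : ℤ → ℝ) := by
      rintro _ ⟨_, ⟨a, ha, rfl⟩, rfl⟩
      obtain ⟨n, hn⟩ := key a ha
      exact ⟨n, by simp [hn]⟩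
    have hd : IsPreconnected ((↑) ⁻¹' ((fun z : ℂ => z.re) '' (f '' s)) : Set ℤ) := by
      refine IsPreconnected.preimage_of_isClosedMap ?_ Int.cast_injective
        Int.isClosedEmbedding_coe_real.isClosedMap ?_
      · simpa using hre
      · simpa using hZ
    have := hd.subsingleton
    rintro _ hx _ hy
    obtain ⟨m, rfl⟩ := hZ (by simpa using hx)
    obtain ⟨n, rfl⟩ := hZ (by simpa using hy)
    congr 1
    exact this (by simpa using hx) (by simpa using hy)
  obtain ⟨m, hm⟩ := key a ha
  obtain ⟨n, hn⟩ := key b hb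
  have h1 := hsub ⟨_, ⟨a, ha, rfl⟩, rfl⟩ ⟨_, ⟨b, hb, rfl⟩, rfl⟩
  simp only [hm, hn, Complex.intCast_re, Int.cast_inj] at h1
  subst h1
  have h2 : f a = f b := by rw [hm, hn]
  simp only [hf] at h2
  exact (div_left_inj' Complex.two_pi_I_ne_zero).1 h2

/-- The identity of a circle around the origin has no continuous logarithm. -/
theorem no_log_circle {r : ℝ} (hr : 0 < r) (G : ℂ → ℂ)
    (hG : ContinuousOn G (Metric.sphere 0 r))
    (h : ∀ z ∈ Metric.sphere (0 : ℂ) r, Complex.exp (G z) = z) : False := by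
  have hmem : ∀ t : ℝ, (r : ℂ) * Complex.exp (t * Complex.I) ∈ Metric.sphere (0 : ℂ) r := by
    intro t
    simp [Complex.norm_exp_ofReal_mul_I, abs_of_pos hr]
  have hL : Continuous fun t : ℝ => G ((r : ℂ) * Complex.exp (t * Complex.I)) :=
    hG.comp_continuous (by fun_prop) hmem
  have := eqOn_sub_of_exp_eq (s := (univ : Set ℝ)) isPreconnected_univ
    (L' := fun t : ℝ => (Real.log r : ℂ) + t * Complex.I) hL.continuousOn
    (by fun_prop) (fun t _ => by
      rw [h _ (hmem t), Complex.exp_add, ← Complex.ofReal_exp, Real.exp_log hr])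
    (mem_univ 0) (mem_univ (2 * Real.pi))
  simp [Complex.exp_two_pi_mul_I] at this

/-- A nowhere vanishing continuous function on the punctured plane is a power times an
exponential. -/
theorem exists_zpow_mul_exp (F : ℂ → ℂ) (hF : ContinuousOn F {0}ᶜ) (h0 : ∀ z ≠ 0, F z ≠ 0) :
    ∃ (d : ℤ) (G : ℂ → ℂ), ContinuousOn G {0}ᶜ ∧ ∀ z ≠ 0, F z = z ^ d * Complex.exp (G z) := by
  have hc : Continuous fun w => F (Complex.exp w) :=
    hF.comp_continuous Complex.continuous_exp (fun w => Complex.exp_ne_zero w)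
  obtain ⟨L, hL, hLe⟩ := exists_continuous_log _ hc (fun w => h0 _ (Complex.exp_ne_zero w))
  have hper : ∀ w, L (w + 2 * Real.pi * Complex.I) - L w = L (2 * Real.pi * Complex.I) - L 0 := by
    intro w
    have := eqOn_sub_of_exp_eq (s := (univ : Set ℂ)) isPreconnected_univ
      (L := fun w => L (w + 2 * Real.pi * Complex.I)) (L' := L)
      (by fun_prop) hL.continuousOn
      (fun w _ => by rw [hLe, hLe, Complex.exp_periodic w]) (mem_univ w) (mem_univ 0)
    simpa using this
  obtain ⟨d, hd⟩ : ∃ d : ℤ, L (2 * Real.pi * Complex.I) - L 0 = d * (2 * Real.pi * Complex.I) := by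
    have : Complex.exp (L (2 * Real.pi * Complex.I)) = Complex.exp (L 0) := by
      rw [hLe, hLe]; simp [Complex.exp_two_pi_mul_I]
    obtain ⟨n, hn⟩ := Complex.exp_eq_exp_iff_exists_int.1 this
    exact ⟨n, by rw [hn]; ring⟩
  have hGper : ∀ w, L (w + 2 * Real.pi * Complex.I) - d * (w + 2 * Real.pi * Complex.I)
      = L w - d * w := by
    intro w
    have := hper w
    rw [hd] at this
    linear_combination this
  have hperiodic : Function.Periodic (fun w => L w - d * w) (2 * Real.pi * Complex.I) := hGper
  have hval : ∀ w, L (Complex.log (Complex.exp w)) - d * Complex.log (Complex.exp w)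
      = L w - d * w := by
    intro w
    obtain ⟨n, hn⟩ := Complex.exp_eq_exp_iff_exists_int.1
      (Complex.exp_log (Complex.exp_ne_zero w))
    rw [hn]
    exact hperiodic.int_mul n w
  refine ⟨d, fun z => L (Complex.log z) - d * Complex.log z, ?_, ?_⟩
  · intro z hz
    apply ContinuousAt.continuousWithinAt
    have hz : z ≠ 0 := hz
    have hop : IsOpenMap Complex.exp := Complex.isOpenMap_exp
    rw [← Complex.exp_log hz]
    have : Tendsto ((fun z => L (Complex.log z) - d * Complex.log z) ∘ Complex.exp)
        (𝓝 (Complex.log z)) (𝓝 (L (Complex.log z) - d * Complex.log z)) := by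
      have : ((fun z => L (Complex.log z) - d * Complex.log z) ∘ Complex.exp)
        = fun w => L w - d * w := funext hval
      rw [this]
      exact Continuous.tendsto (f := fun w => L w - d * w) (by fun_prop) _
    rw [ContinuousAt]
    have hle := hop.nhds_le (Complex.log z)
    refine Tendsto.mono_left ?_ hle
    rw [tendsto_map'_iff]
    simpa [hval] using this
  · intro z hz
    have := hLe (Complex.log z)
    rw [Complex.exp_log hz] at this
    rw [← this, Complex.exp_sub, Complex.exp_int_mul, Complex.exp_log hz]
    field_simp

end

section

/-- A continuous bijection which is the identity off a compact set is a homeomorphism. -/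
theorem isHomeomorph_of_eq_off_compact {X : Type*} [TopologicalSpace X] [T2Space X] {f : X → X}
    (hf : Continuous f) (hb : Function.Bijective f) {K : Set X} (hK : IsCompact K)
    (hid : ∀ x ∉ K, f x = x) : IsHomeomorph f := by
  rw [isHomeomorph_iff_continuous_isClosedMap_bijective]
  refine ⟨hf, fun A hA => ?_, hb⟩
  have hcl : ∀ x ∈ closure Kᶜ, f x = x := fun x hx =>
    (Set.EqOn.closure (f := f) (g := id) hid hf continuous_id) hx
  have : f '' A = f '' (A ∩ K) ∪ (A ∩ closure Kᶜ) := by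
    ext y
    constructor
    · rintro ⟨x, hx, rfl⟩
      by_cases hxK : x ∈ K
      · exact Or.inl ⟨x, ⟨hx, hxK⟩, rfl⟩
      · rw [hid x hxK]
        exact Or.inr ⟨hx, subset_closure hxK⟩
    · rintro (⟨x, hx, rfl⟩ | hy)
      · exact ⟨x, hx.1, rfl⟩
      · exact ⟨y, hy.1, hcl y hy.2⟩
  rw [this]
  exact ((hK.inter_left hA).image hf).isClosed.union (hA.inter isClosed_closure)

/-- Extension of a compactly supported homeomorphism along an open embedding. -/
theorem exists_homeomorph_extend {X Y : Type*} [TopologicalSpace X] [T2Space X]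
    [TopologicalSpace Y] {Φ : Y → X} (hΦ : IsOpenEmbedding Φ) {g : Y → Y} (hg : Continuous g)
    (hgb : Function.Bijective g) {K : Set Y} (hK : IsCompact K) (hid : ∀ y ∉ K, g y = y) :
    ∃ Θ : X ≃ₜ X, (∀ y, Θ (Φ y) = Φ (g y)) ∧ (∀ x ∉ Φ '' K, Θ x = x) := by
  classical
  set f : X → X := Function.extend Φ (Φ ∘ g) id with hf
  have hfΦ : ∀ y, f (Φ y) = Φ (g y) := fun y => hΦ.injective.extend_apply _ _ y
  have hfn : ∀ x ∉ range Φ, f x = x := fun x hx => by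
    rw [hf, Function.extend_apply' _ _ _ (by simpa using hx)]; rfl
  have hKc : IsCompact (Φ '' K) := hK.image hΦ.continuous
  have hfK : ∀ x ∉ Φ '' K, f x = x := by
    intro x hx
    by_cases hr : x ∈ range Φ
    · obtain ⟨y, rfl⟩ := hr
      rw [hfΦ, hid y (fun h => hx ⟨y, h, rfl⟩)]
    · exact hfn x hr
  have hcont : Continuous f := by
    rw [continuous_iff_continuousAt]
    intro x
    by_cases hr : x ∈ range Φ
    · obtain ⟨y, rfl⟩ := hr
      rw [ContinuousAt, ← hΦ.map_nhds_eq y, tendsto_map'_iff, hfΦ]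
      have : f ∘ Φ = Φ ∘ g := funext hfΦ
      rw [this]
      exact (hΦ.continuous.comp hg).continuousAt
    · have hx : x ∉ Φ '' K := fun ⟨y, _, hy⟩ => hr ⟨y, hy⟩
      have : f =ᶠ[𝓝 x] id := by
        filter_upwards [hKc.isClosed.isOpen_compl.mem_nhds hx] with z hz
        exact hfK z hz
      exact continuousAt_id.congr this.symm
  have hbij : Function.Bijective f := by
    constructor
    · intro x x' h
      by_cases hr : x ∈ range Φ <;> by_cases hr' : x' ∈ range Φ
      · obtain ⟨y, rfl⟩ := hr
        obtain ⟨y', rfl⟩ := hr'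
        rw [hfΦ, hfΦ] at h
        rw [hgb.1 (hΦ.injective h)]
      · obtain ⟨y, rfl⟩ := hr
        rw [hfΦ, hfn _ hr'] at h
        exact absurd ⟨_, h⟩ hr'
      · obtain ⟨y, rfl⟩ := hr'
        rw [hfΦ, hfn _ hr] at h
        exact absurd ⟨_, h.symm⟩ hr
      · rwa [hfn _ hr, hfn _ hr'] at h
    · intro x
      by_cases hr : x ∈ range Φ
      · obtain ⟨y, rfl⟩ := hr
        obtain ⟨y', rfl⟩ := hgb.2 y
        exact ⟨Φ y', hfΦ y'⟩
      · exact ⟨x, hfn x hr⟩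
  have hh := isHomeomorph_of_eq_off_compact hcont hbij hKc hfK
  exact ⟨hh.homeomorph f, hfΦ, hfK⟩

/-- A contractive perturbation of the identity is bijective. -/
theorem bijective_add_of_lipschitz {E : Type*} [NormedAddCommGroup E] [NormedSpace ℝ E]
    [CompleteSpace E] {φ : E → E} {c : NNReal} (hφ : LipschitzWith c φ) (hc : c < 1) :
    Function.Bijective fun x => x + φ x := by
  rcases subsingleton_or_nontrivial E with h | h
  · exact ⟨fun _ _ _ => Subsingleton.elim _ _, fun y => ⟨y, Subsingleton.elim _ _⟩⟩
  have happ : ApproximatesLinearOn (fun x => x + φ x)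
      ((ContinuousLinearEquiv.refl ℝ E : E ≃L[ℝ] E) : E →L[ℝ] E) univ c := by
    intro x _ y _
    have := hφ.dist_le_mul x y
    rw [dist_eq_norm, dist_eq_norm] at this
    have heq : x + φ x - (y + φ y) - (x - y) = φ x - φ y := by abel
    change ‖x + φ x - (y + φ y) - (x - y)‖ ≤ _
    rwa [heq]
  have hc' : c < ‖((ContinuousLinearEquiv.refl ℝ E).symm : E →L[ℝ] E)‖₊⁻¹ := by
    have : ‖((ContinuousLinearEquiv.refl ℝ E).symm : E →L[ℝ] E)‖₊ = 1 := by
      have h1 : ((ContinuousLinearEquiv.refl ℝ E).symm : E →L[ℝ] E) = ContinuousLinearMap.id ℝ E :=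
        rfl
      rw [h1]
      exact ContinuousLinearMap.nnnorm_id
    rw [this]; simpa using hc
  exact (ApproximatesLinearOn.toHomeomorph _ happ (Or.inr hc')).bijective

/-- A point is planar if it has an open neighbourhood homeomorphic to the plane. -/
def IsPlanar {X : Type*} [TopologicalSpace X] (x : X) : Prop :=
  ∃ e : ℂ → X, IsOpenEmbedding e ∧ e 0 = x

theorem IsPlanar.exists_subset {X : Type*} [TopologicalSpace X] {x : X} (h : IsPlanar x)
    {O : Set X} (hO : O ∈ 𝓝 x) : ∃ e : ℂ → X, IsOpenEmbedding e ∧ e 0 = x ∧ range e ⊆ O := by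
  obtain ⟨e, he, rfl⟩ := h
  obtain ⟨r, hr, hrO⟩ := Metric.mem_nhds_iff.1 (he.continuous.continuousAt hO)
  let u := OpenPartialHomeomorph.univBall (0 : ℂ) r
  have hu : IsOpenEmbedding u := u.isOpenEmbedding (OpenPartialHomeomorph.univBall_source _ _)
  refine ⟨e ∘ u, he.comp hu, by simp [u], ?_⟩
  rintro _ ⟨z, rfl⟩
  apply hrO
  rw [← OpenPartialHomeomorph.univBall_target (0 : ℂ) hr]
  exact u.map_source (by simp [u])

theorem isPlanar_of_isOpenEmbedding {X Y : Type*} [TopologicalSpace X] [TopologicalSpace Y]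
    {f : Y → X} (hf : IsOpenEmbedding f) {y : Y} (hy : IsPlanar y) : IsPlanar (f y) := by
  obtain ⟨e, he, rfl⟩ := hy
  exact ⟨f ∘ e, hf.comp he, rfl⟩

theorem isPlanar_complex (z : ℂ) : IsPlanar z :=
  ⟨fun w => w + z, (Homeomorph.addRight z).isOpenEmbedding, by simp⟩

theorem IsPlanar.subtype {X : Type*} [TopologicalSpace X] {x : X} (h : IsPlanar x)
    {O : Set X} (hO : IsOpen O) (hx : x ∈ O) : IsPlanar (⟨x, hx⟩ : O) := by
  obtain ⟨e, he, h0, hr⟩ := h.exists_subset (hO.mem_nhds hx)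
  refine ⟨fun z => ⟨e z, hr (mem_range_self z)⟩, ?_, Subtype.ext h0⟩
  exact IsOpenEmbedding.of_comp _ hO.isOpenEmbedding_subtypeVal he

theorem isOpen_isPlanar {X : Type*} [TopologicalSpace X] : IsOpen {x : X | IsPlanar x} := by
  rw [isOpen_iff_mem_nhds]
  rintro x ⟨e, he, rfl⟩
  filter_upwards [he.isOpen_range.mem_nhds (mem_range_self 0)]
  rintro _ ⟨z, rfl⟩
  exact isPlanar_of_isOpenEmbedding he (isPlanar_complex z)

/-- Homogeneity of connected open sets of planar points. -/
theorem exists_homeomorph_map_eq {X : Type*} [TopologicalSpace X] [T2Space X] {U : Set X}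
    (hU : IsOpen U) (hc : IsPreconnected U) (hp : ∀ x ∈ U, IsPlanar x) {x y : X} (hx : x ∈ U)
    (hy : y ∈ U) :
    ∃ Θ : X ≃ₜ X, Θ x = y ∧ ∃ K ⊆ U, IsCompact K ∧ ∀ z ∉ K, Θ z = z := by
  refine hc.induction₂ (fun x y => ∃ Θ : X ≃ₜ X, Θ x = y ∧ ∃ K ⊆ U, IsCompact K ∧
    ∀ z ∉ K, Θ z = z) ?_ ?_ ?_ hx hy
  · intro x hx
    obtain ⟨e, he, rfl, hr⟩ := (hp x hx).exists_subset (hU.mem_nhds hx)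
    have hn : e '' Metric.ball 0 1 ∈ 𝓝 (e 0) :=
      he.isOpenMap.image_mem_nhds (Metric.ball_mem_nhds 0 one_pos)
    filter_upwards [mem_nhdsWithin_of_mem_nhds hn]
    rintro _ ⟨w, hw, rfl⟩
    have hw : ‖w‖ < 1 := by simpa using hw
    have hlip : LipschitzWith ‖w‖₊ fun z : ℂ => (max 0 (1 - ‖z‖) : ℝ) • w := by
      refine LipschitzWith.of_dist_le_mul fun z z' => ?_
      rw [dist_eq_norm, ← sub_smul, norm_smul, mul_comm, coe_nnnorm]
      refine mul_le_mul_of_nonneg_left ?_ (norm_nonneg _)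
      rw [Real.norm_eq_abs]
      calc |max 0 (1 - ‖z‖) - max 0 (1 - ‖z'‖)| ≤ |(1 - ‖z‖) - (1 - ‖z'‖)| := by
            rw [max_comm 0, max_comm 0]; exact abs_max_sub_max_le_abs (1 - ‖z‖) (1 - ‖z'‖) 0
        _ = |‖z'‖ - ‖z‖| := by congr 1; ring
        _ ≤ ‖z' - z‖ := abs_norm_sub_norm_le _ _
        _ = dist z z' := by rw [dist_comm, dist_eq_norm]
    obtain ⟨Θ, hΘ, hid⟩ := exists_homeomorph_extend he (g := fun z => z + (max 0 (1 - ‖z‖) : ℝ) • w)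
      (by fun_prop) (bijective_add_of_lipschitz hlip (by exact_mod_cast hw))
      (isCompact_closedBall (0 : ℂ) 1) (fun z hz => by
        have : 1 - ‖z‖ ≤ 0 := by
          have : 1 < ‖z‖ := by simpa using hz
          linarith
        simp [max_eq_left this])
    refine ⟨Θ, by simp [hΘ], _, ?_, (isCompact_closedBall (0 : ℂ) 1).image he.continuous, hid⟩
    exact (image_subset_range _ _).trans hr
  · rintro x y z _ _ _ ⟨Θ, rfl, K, hKU, hK, hid⟩ ⟨Θ', rfl, K', hKU', hK', hid'⟩
    refine ⟨Θ.trans Θ', rfl, K ∪ K', union_subset hKU hKU', hK.union hK', fun z hz => ?_⟩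
    simp only [mem_union, not_or] at hz
    rw [Homeomorph.trans_apply, hid z hz.1, hid' z hz.2]
  · rintro x y _ _ ⟨Θ, rfl, K, hKU, hK, hid⟩
    refine ⟨Θ.symm, by simp, K, hKU, hK, fun z hz => ?_⟩
    rw [Homeomorph.symm_apply_eq, hid z hz]

end

section

theorem exists_continuousOn_log {A : Type*} [TopologicalSpace A] {S : Set A} [ContractibleSpace S]
    (F : A → ℂ) (hF : ContinuousOn F S) (h0 : ∀ a ∈ S, F a ≠ 0) :
    ∃ L : A → ℂ, ContinuousOn L S ∧ ∀ a ∈ S, Complex.exp (L a) = F a := by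
  classical
  obtain ⟨L, hL, hLe⟩ := exists_continuous_log (S.domRestrict F) hF.domRestrict
    (fun a => h0 a a.2)
  refine ⟨fun a => if h : a ∈ S then L ⟨a, h⟩ else 0, ?_, fun a ha => by
    simp only [ha, dif_pos]; exact hLe ⟨a, ha⟩⟩
  rw [continuousOn_iff_continuous_domRestrict]
  convert hL using 1
  ext a
  simp

theorem StrictMono.isOpenEmbedding_of_range {α β : Type*} [LinearOrder α] [TopologicalSpace α]
    [OrderTopology α] [LinearOrder β] [TopologicalSpace β] [OrderTopology β] {f : α → β}
    (hf : StrictMono f) (ho : IsOpen (range f)) (hc : OrdConnected (range f)) :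
    IsOpenEmbedding f :=
  ⟨StrictMono.isEmbedding_of_ordConnected hf hc, ho⟩

theorem isOpenEmbedding_symm_comp {X Y Z : Type*} [TopologicalSpace X] [TopologicalSpace Y]
    [TopologicalSpace Z] [Nonempty Y] (ψ : OpenPartialHomeomorph X Z) {f : Y → Z}
    (hf : IsOpenEmbedding f) (hr : range f ⊆ ψ.target) : IsOpenEmbedding (ψ.symm ∘ f) := by
  have := ((hf.toOpenPartialHomeomorph f).trans ψ.symm).isOpenEmbedding (by
    ext y
    simp only [OpenPartialHomeomorph.trans_source, mem_inter_iff, mem_preimage, mem_univ, iff_true]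
    exact ⟨by simp, hr (mem_range_self y)⟩)
  exact this

/-- A point is an edge point if it has an open neighbourhood homeomorphic to the half-plane,
with the point corresponding to the origin. -/
def IsEdge {X : Type*} [TopologicalSpace X] (x : X) : Prop :=
  ∃ e : ℝ × NNReal → X, IsOpenEmbedding e ∧ e (0, 0) = x

theorem exists_squeeze_nnreal {r : NNReal} (hr : 0 < r) :
    ∃ σ : NNReal → NNReal, IsOpenEmbedding σ ∧ σ 0 = 0 ∧ ∀ s, σ s < r := by
  have hlt : ∀ s : NNReal, r * (s / (1 + s)) < r := by
    intro s
    have : s / (1 + s) < 1 := by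
      rw [div_lt_one (by positivity)]
      exact lt_one_add s
    calc r * (s / (1 + s)) < r * 1 := by gcongr
      _ = r := mul_one r
  refine ⟨fun s => r * (s / (1 + s)), ?_, by simp, hlt⟩
  have hrange : range (fun s : NNReal => r * (s / (1 + s))) = Iio r := by
    ext y
    constructor
    · rintro ⟨s, rfl⟩; exact hlt s
    · intro hy
      have hy : y < r := hy
      refine ⟨y / (r - y), ?_⟩
      have h1 : 0 < r - y := tsub_pos_of_lt hy
      have h2 : (r - y) + y = r := tsub_add_cancel_of_le hy.le
      have h3 : 1 + y / (r - y) = r / (r - y) := by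
        rw [eq_div_iff h1.ne', add_mul, div_mul_cancel₀ _ h1.ne', one_mul, h2]
      simp only [h3]
      field_simp
  refine StrictMono.isOpenEmbedding_of_range ?_ (hrange ▸ isOpen_Iio) (hrange ▸ ordConnected_Iio)
  intro s t hst
  have : s / (1 + s) < t / (1 + t) := by
    rw [div_lt_div_iff₀ (by positivity) (by positivity)]
    rw [mul_add, mul_add, mul_one, mul_one, mul_comm t s]
    gcongr
  show r * _ < r * _
  gcongr

theorem exists_squeeze_halfPlane (b : ℝ) {O : Set (ℝ × NNReal)} (hO : O ∈ 𝓝 (b, (0 : NNReal))) :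
    ∃ σ : ℝ → ℝ, ∃ τ : NNReal → NNReal, IsOpenEmbedding σ ∧ IsOpenEmbedding τ ∧ σ 0 = b ∧ τ 0 = 0 ∧
      ∀ p : ℝ × NNReal, (σ p.1, τ p.2) ∈ O := by
  rw [nhds_prod_eq, mem_prod_iff] at hO
  obtain ⟨A, hA, B, hB, hAB⟩ := hO
  obtain ⟨r, hr, hrA⟩ := Metric.mem_nhds_iff.1 hA
  obtain ⟨r', hr', hrB⟩ := Metric.mem_nhds_iff.1 hB
  let u := OpenPartialHomeomorph.univBall b r
  obtain ⟨τ, hτ, hτ0, hτr⟩ := exists_squeeze_nnreal (r := ⟨r', hr'.le⟩) (by exact_mod_cast hr')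
  refine ⟨u, τ, u.isOpenEmbedding (OpenPartialHomeomorph.univBall_source _ _), hτ, by simp [u],
    hτ0, fun p => hAB ⟨hrA ?_, hrB ?_⟩⟩
  · rw [← OpenPartialHomeomorph.univBall_target b hr]
    exact u.map_source (by simp [u])
  · have := hτr p.2
    rw [Metric.mem_ball, NNReal.dist_eq]
    have h1 : ((τ p.2 : NNReal) : ℝ) < r' := by exact_mod_cast this
    simpa [abs_of_nonneg] using h1

theorem isPlanar_halfPlane (b : ℝ) {s : NNReal} (hs : 0 < s) : IsPlanar ((b, s) : ℝ × NNReal) := by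
  have hs' : (0 : ℝ) < s := by exact_mod_cast hs
  let f : ℝ → NNReal := fun t => ⟨s * Real.exp t, by positivity⟩
  have hr : range f = Ioi 0 := by
    ext y
    constructor
    · rintro ⟨t, rfl⟩
      show (0 : ℝ) < s * Real.exp t
      positivity
    · intro hy
      have hy : (0 : ℝ) < y := by exact_mod_cast hy
      refine ⟨Real.log (y / s), NNReal.eq ?_⟩
      show (s : ℝ) * Real.exp (Real.log (y / s)) = y
      rw [Real.exp_log (by positivity)]
      field_simp
  have hf : IsOpenEmbedding f := by
    refine StrictMono.isOpenEmbedding_of_range ?_ (hr ▸ isOpen_Ioi) (hr ▸ ordConnected_Ioi)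
    intro t t' h
    show (s : ℝ) * Real.exp t < s * Real.exp t'
    gcongr
  refine ⟨Prod.map (fun t => t + b) f ∘ Complex.equivRealProdCLM, ?_, ?_⟩
  · exact ((Homeomorph.addRight b).isOpenEmbedding.prodMap hf).comp
      Complex.equivRealProdCLM.toHomeomorph.isOpenEmbedding
  · refine Prod.ext (zero_add b) (NNReal.eq ?_)
    change (s : ℝ) * Real.exp 0 = s
    simp

theorem IsEdge.exists_subset {X : Type*} [TopologicalSpace X] {x : X} (h : IsEdge x)
    {O : Set X} (hO : O ∈ 𝓝 x) :
    ∃ e : ℝ × NNReal → X, IsOpenEmbedding e ∧ e (0, 0) = x ∧ range e ⊆ O := by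
  obtain ⟨e, he, rfl⟩ := h
  obtain ⟨σ, τ, hσ, hτ, h0, h0', hsub⟩ :=
    exists_squeeze_halfPlane 0 (he.continuous.continuousAt hO)
  refine ⟨e ∘ Prod.map σ τ, he.comp (hσ.prodMap hτ), by simp [h0, h0'], ?_⟩
  rintro _ ⟨p, rfl⟩
  exact hsub p

/-- Invariance of the boundary in dimension two. -/
theorem IsEdge.not_isPlanar {X : Type*} [TopologicalSpace X] {x : X} (h : IsEdge x) :
    ¬ IsPlanar x := by
  rintro ⟨f, hf, rfl⟩
  obtain ⟨e, he, he0, hr⟩ := h.exists_subset (hf.isOpen_range.mem_nhds (mem_range_self 0))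
  let E := he.toOpenPartialHomeomorph e
  let F := hf.toOpenPartialHomeomorph f
  have hFf : ∀ z, F.symm (f z) = z := fun z => F.left_inv (by simp [F])
  have hEe : ∀ p, E.symm (e p) = p := fun p => E.left_inv (by simp [E])
  have hfF : ∀ p, f (F.symm (e p)) = e p := fun p => F.right_inv (by simpa [F] using hr ⟨p, rfl⟩)
  let S : Set (ℝ × ℝ) := {p | 0 ≤ p.2 ∧ p ≠ 0}
  have hstar : StarConvex ℝ ((0, 1) : ℝ × ℝ) S := by
    rintro ⟨t, s⟩ ⟨hs, hne⟩ a b ha hb hab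
    simp only at hs
    refine ⟨by simp; positivity, ?_⟩
    intro h
    simp only [Prod.smul_mk, smul_eq_mul, mul_zero, mul_one, Prod.mk_add_mk, zero_add,
      Prod.mk_eq_zero] at h
    obtain ⟨h1, h2⟩ := h
    have hbs : 0 ≤ b * s := by positivity
    have ha0 : a = 0 := by linarith
    have hb1 : b = 1 := by linarith
    subst hb1
    apply hne
    simp [Prod.ext_iff] at *
    constructor <;> linarith
  have : ContractibleSpace S := hstar.contractibleSpace ⟨(0, 1), by simp [S]⟩
  let P : ℝ × ℝ → ℝ × NNReal := fun p => (p.1, Real.toNNReal p.2)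
  have hPc : Continuous P := by fun_prop
  have hcont : Continuous fun p => F.symm (e (P p)) := by
    refine F.continuousOn_symm.comp_continuous (he.continuous.comp hPc) fun p => ?_
    simpa [F] using hr ⟨_, rfl⟩
  obtain ⟨L, hL, hLe⟩ := exists_continuousOn_log (S := S) (fun p => F.symm (e (P p)))
    hcont.continuousOn (by
      rintro ⟨t, s⟩ ⟨hs, hne⟩ h
      have h1 := hfF (P (t, s))
      rw [h, ← he0] at h1
      have h2 := he.injective h1
      simp only [P, Prod.mk.injEq] at h2
      apply hne
      have hs' : s ≤ 0 := Real.toNNReal_eq_zero.1 h2.2.symm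
      exact Prod.ext h2.1.symm (le_antisymm hs' hs))
  have hnhds : f ⁻¹' (range e) ∈ 𝓝 (0 : ℂ) :=
    hf.continuous.continuousAt (he.isOpen_range.mem_nhds ⟨_, he0⟩)
  obtain ⟨r, hr0, hrsub⟩ := Metric.nhds_basis_closedBall.mem_iff.1 hnhds
  let Q : ℂ → ℝ × ℝ := fun z => ((E.symm (f z)).1, ((E.symm (f z)).2 : ℝ))
  have hsph : ∀ z ∈ Metric.sphere (0 : ℂ) r, f z ∈ range e := fun z hz =>
    hrsub (Metric.sphere_subset_closedBall hz)
  have hPQ : ∀ z, P (Q z) = E.symm (f z) := fun z => by simp [P, Q]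
  have heE : ∀ z ∈ Metric.sphere (0 : ℂ) r, e (E.symm (f z)) = f z := fun z hz =>
    E.right_inv (by simpa [E] using hsph z hz)
  have hQS : ∀ z ∈ Metric.sphere (0 : ℂ) r, Q z ∈ S := by
    intro z hz
    refine ⟨by simp [Q], fun h => ?_⟩
    have h1 := hPQ z
    rw [h] at h1
    have h2 := heE z hz
    rw [← h1] at h2
    have h3 : P 0 = (0, 0) := by simp [P]
    rw [h3, he0] at h2
    have := hf.injective h2
    subst this
    simp at hz
    exact hr0.ne hz
  refine no_log_circle hr0 (fun z => L (Q z)) ?_ ?_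
  · refine hL.comp ?_ hQS
    have h1 : ContinuousOn (fun z => E.symm (f z)) (Metric.sphere (0 : ℂ) r) :=
      E.continuousOn_symm.comp hf.continuous.continuousOn (fun z hz => by
        simpa [E] using hsph z hz)
    fun_prop
  · intro z hz
    rw [hLe _ (hQS z hz), hPQ, heE z hz, hFf]

theorem not_isPlanar_edge {X : Type*} [TopologicalSpace X] {e : ℝ × NNReal → X}
    (he : IsOpenEmbedding e) (t : ℝ) : ¬ IsPlanar (e (t, 0)) := by
  refine IsEdge.not_isPlanar ⟨e ∘ Prod.map (fun x => x + t) id, he.comp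
    ((Homeomorph.addRight t).isOpenEmbedding.prodMap IsOpenEmbedding.id), by simp⟩

theorem isPlanar_iff_of_edge {X : Type*} [TopologicalSpace X] {e : ℝ × NNReal → X}
    (he : IsOpenEmbedding e) (p : ℝ × NNReal) : IsPlanar (e p) ↔ 0 < p.2 := by
  obtain ⟨t, s⟩ := p
  refine ⟨fun h => ?_, fun h => isPlanar_of_isOpenEmbedding he (isPlanar_halfPlane t h)⟩
  by_contra h0
  have : s = 0 := by simpa using h0
  subst this
  exact not_isPlanar_edge he t h

theorem isPlanar_homeomorph {X : Type*} [TopologicalSpace X] (f : X ≃ₜ X) {x : X} :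
    IsPlanar (f x) ↔ IsPlanar x :=
  ⟨fun h => by simpa using isPlanar_of_isOpenEmbedding f.symm.isOpenEmbedding h,
    isPlanar_of_isOpenEmbedding f.isOpenEmbedding⟩

end

section

/-- Coordinates identifying the Euclidean half-plane with `ℝ × ℝ≥0`. -/
def halfPlaneHomeomorph : EuclideanHalfSpace 2 ≃ₜ ℝ × NNReal where
  toFun p := (p.1 1, ⟨p.1 0, p.2⟩)
  invFun q := ⟨!₂[(q.2 : ℝ), q.1], q.2.2⟩
  left_inv p := by
    refine Subtype.ext ?_
    ext i
    fin_cases i <;> rfl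
  right_inv q := rfl
  continuous_toFun := by
    have h : Continuous fun p : EuclideanHalfSpace 2 => p.1 := continuous_subtype_val
    exact ((PiLp.continuous_apply 2 _ 1).comp h).prodMk
      (((PiLp.continuous_apply 2 _ 0).comp h).subtype_mk _)
  continuous_invFun := by
    refine Continuous.subtype_mk (?_ : Continuous fun q : ℝ × NNReal => !₂[(q.2 : ℝ), q.1]) _
    fun_prop

section Manifold

variable {M : Type*} [TopologicalSpace M] [ChartedSpace (EuclideanHalfSpace 2) M]

theorem isPlanar_or_isEdge_chart (x : M) :
    (x ∈ surfaceBoundary M → IsEdge x) ∧ (x ∉ surfaceBoundary M → IsPlanar x) := by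
  let ψ := (chartAt (EuclideanHalfSpace 2) x).trans halfPlaneHomeomorph.toOpenPartialHomeomorph
  have hx : x ∈ ψ.source := by simp [ψ]
  have hb : x ∈ surfaceBoundary M ↔ (ψ x).2 = 0 := by
    change extChartAt _ x x ∈ frontier _ ↔ _
    rw [frontier_range_modelWithCornersEuclideanHalfSpace]
    constructor
    · intro h
      exact NNReal.eq (Eq.symm h)
    · intro h
      exact (congrArg NNReal.toReal h).symm
  have ht : ψ.target ∈ 𝓝 (ψ x) := ψ.open_target.mem_nhds (ψ.map_source hx)
  rw [hb]
  refine ⟨fun h => ?_, fun h => ?_⟩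
  · obtain ⟨σ, τ, hσ, hτ, h0, h0', hsub⟩ := exists_squeeze_halfPlane (ψ x).1 (O := ψ.target) (by
      convert ht using 2; exact Prod.ext rfl h.symm)
    refine ⟨ψ.symm ∘ Prod.map σ τ, isOpenEmbedding_symm_comp ψ (hσ.prodMap hτ) ?_, ?_⟩
    · rintro _ ⟨p, rfl⟩
      exact hsub p
    · have : Prod.map σ τ (0, 0) = ψ x := Prod.ext h0 (h0'.trans h.symm)
      rw [Function.comp_apply, this, ψ.left_inv hx]
  · obtain ⟨e, he, he0, hr⟩ :=
      (isPlanar_halfPlane (ψ x).1 (pos_iff_ne_zero.2 h)).exists_subset ht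
    refine ⟨ψ.symm ∘ e, isOpenEmbedding_symm_comp ψ he hr, ?_⟩
    rw [Function.comp_apply, he0]
    exact ψ.left_inv hx

theorem surfaceBoundary_eq : surfaceBoundary M = {x : M | ¬ IsPlanar x} := by
  ext x
  by_cases h : x ∈ surfaceBoundary M
  · exact iff_of_true h ((isPlanar_or_isEdge_chart x).1 h).not_isPlanar
  · exact iff_of_false h (fun h' => h' ((isPlanar_or_isEdge_chart x).2 h))

theorem isPlanar_or_isEdge (x : M) : IsPlanar x ∨ IsEdge x := by
  by_cases h : x ∈ surfaceBoundary M
  · exact .inr ((isPlanar_or_isEdge_chart x).1 h)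
  · exact .inl ((isPlanar_or_isEdge_chart x).2 h)

end Manifold

section Surface

variable {M : Type*} [TopologicalSpace M]

theorem exists_good_nhd (hM : ∀ x : M, IsPlanar x ∨ IsEdge x) {x : M} {O : Set M}
    (hO : O ∈ 𝓝 x) :
    ∃ W ⊆ O, x ∈ W ∧ IsOpen W ∧ IsPreconnected W ∧ IsPreconnected (W ∩ {y | IsPlanar y}) ∧
      (W ∩ {y | IsPlanar y}).Nonempty := by
  rcases hM x with h | h
  · obtain ⟨e, he, rfl, hr⟩ := h.exists_subset hO
    have hp : range e ∩ {y | IsPlanar y} = range e := inter_eq_left.2 (by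
      rintro _ ⟨z, rfl⟩
      exact isPlanar_of_isOpenEmbedding he (isPlanar_complex z))
    have hc := isPreconnected_range he.continuous
    rw [← hp] at hc
    exact ⟨range e, hr, mem_range_self _, he.isOpen_range, hp ▸ hc, hc, by
      rw [hp]; exact range_nonempty e⟩
  · obtain ⟨e, he, rfl, hr⟩ := h.exists_subset hO
    have hp : range e ∩ {y | IsPlanar y} = e '' (univ ×ˢ Ioi 0) := by
      ext y
      constructor
      · rintro ⟨⟨p, rfl⟩, hy⟩
        exact ⟨p, ⟨mem_univ _, (isPlanar_iff_of_edge he p).1 hy⟩, rfl⟩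
      · rintro ⟨p, ⟨-, hp⟩, rfl⟩
        exact ⟨mem_range_self _, (isPlanar_iff_of_edge he p).2 hp⟩
    refine ⟨range e, hr, mem_range_self _, he.isOpen_range, isPreconnected_range he.continuous,
      ?_, ?_⟩
    · rw [hp]
      exact (isPreconnected_univ.prod isPreconnected_Ioi).image _ he.continuous.continuousOn
    · rw [hp]
      exact ⟨_, (0, 1), ⟨mem_univ _, zero_lt_one (α := NNReal)⟩, rfl⟩

theorem dense_isPlanar (hM : ∀ x : M, IsPlanar x ∨ IsEdge x) : Dense {y : M | IsPlanar y} := by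
  intro x
  rw [mem_closure_iff_nhds]
  intro O hO
  obtain ⟨W, hW, -, -, -, -, h⟩ := exists_good_nhd hM hO
  exact h.mono (inter_subset_inter_left _ hW)

theorem isPreconnected_isPlanar [PreconnectedSpace M]
    (hM : ∀ x : M, IsPlanar x ∨ IsEdge x) : IsPreconnected {y : M | IsPlanar y} := by
  refine isPreconnected_of_forall_pair fun x₀ hx₀ x₁ hx₁ => ?_
  set P := {y : M | IsPlanar y}
  set D := connectedComponentIn P x₀
  have hDc : IsPreconnected D := isPreconnected_connectedComponentIn
  have hD0 : x₀ ∈ D := mem_connectedComponentIn hx₀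
  have hmeet : ∀ W : Set M, IsPreconnected (W ∩ P) → (W ∩ P ∩ D).Nonempty → W ∩ P ⊆ D := by
    rintro W hW ⟨z, hz, hzD⟩
    have : D = connectedComponentIn P z := connectedComponentIn_eq hzD
    rw [this]
    exact hW.subset_connectedComponentIn hz inter_subset_right
  let T := {x : M | ∀ᶠ y in 𝓝 x, y ∈ P → y ∈ D}
  have hTo : IsOpen T := isOpen_setOfPred_eventually_nhds
  have hTc : IsOpen Tᶜ := by
    rw [isOpen_iff_mem_nhds]
    intro x hx
    obtain ⟨W, -, hxW, hWo, -, hWP, -⟩ := exists_good_nhd hM (x := x) univ_mem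
    filter_upwards [hWo.mem_nhds hxW] with y hyW hyT
    obtain ⟨O, hOT, hOo, hyO⟩ := mem_nhds_iff.1 hyT
    obtain ⟨z, ⟨hzO, hzW⟩, hzP⟩ := (dense_isPlanar hM).inter_open_nonempty (O ∩ W) (hOo.inter hWo)
      ⟨y, hyO, hyW⟩
    have := hmeet W hWP ⟨z, ⟨hzW, hzP⟩, hOT hzO hzP⟩
    exact hx (mem_of_superset (hWo.mem_nhds hxW) fun w hw hwP => this ⟨hw, hwP⟩)
  have hx0T : x₀ ∈ T := by
    obtain ⟨W, -, hxW, hWo, -, hWP, -⟩ := exists_good_nhd hM (x := x₀) univ_mem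
    have := hmeet W hWP ⟨x₀, ⟨hxW, hx₀⟩, hD0⟩
    exact mem_of_superset (hWo.mem_nhds hxW) fun w hw hwP => this ⟨hw, hwP⟩
  have hTu : T = univ := IsClopen.eq_univ ⟨⟨hTc⟩, hTo⟩ ⟨x₀, hx0T⟩
  have hx1T : x₁ ∈ T := hTu ▸ mem_univ _
  exact ⟨D, connectedComponentIn_subset _ _, hD0, hx1T.self_of_nhds hx₁, hDc⟩

/-- A subset near each of whose points there is a half-plane chart in which the subset is
the edge. -/
def IsLocallyEdge (C : Set M) : Prop :=
  ∀ c ∈ C, ∃ e : ℝ × NNReal → M, IsOpenEmbedding e ∧ e (0, 0) = c ∧ ∀ p, e p ∈ C ↔ p.2 = 0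

theorem isLocallyEdge_component (hM : ∀ x : M, IsPlanar x ∨ IsEdge x) (x : M) :
    IsLocallyEdge (connectedComponentIn {y : M | ¬ IsPlanar y} x) := by
  intro c hc
  have hcP : ¬ IsPlanar c := connectedComponentIn_subset _ _ hc
  obtain ⟨e, he, rfl⟩ := (hM c).resolve_left hcP
  refine ⟨e, he, rfl, fun p => ⟨fun hp => ?_, fun hp => ?_⟩⟩
  · have h1 : ¬ IsPlanar (e p) := connectedComponentIn_subset _ _ hp
    rw [isPlanar_iff_of_edge he] at h1
    simpa using h1
  · have h1 : IsPreconnected (e '' (univ ×ˢ {0})) :=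
      (isPreconnected_univ.prod isPreconnected_singleton).image _ he.continuous.continuousOn
    rw [connectedComponentIn_eq hc]
    refine h1.subset_connectedComponentIn ⟨(0, 0), by simp, rfl⟩ ?_ ⟨p, by simpa using hp, rfl⟩
    rintro _ ⟨q, ⟨-, hq⟩, rfl⟩
    obtain ⟨t, s⟩ := q
    simp only [mem_singleton_iff] at hq
    subst hq
    exact not_isPlanar_edge he t

end Surface

end

section

section Collar

variable {X : Type*}

/-- The space `X` with an exterior collar attached along `C`. -/
abbrev CollarExt (C : Set X) : Type _ := {p : X × ℝ // p.2 = 0 ∨ (p.1 ∈ C ∧ p.2 ≤ 0)}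

/-- The chart of the collar extension induced by a half-plane chart. -/
def collarChart {C : Set X} (e : ℝ × NNReal → X) (heC : ∀ p, e p ∈ C ↔ p.2 = 0) (p : ℝ × ℝ) :
    CollarExt C :=
  ⟨(e (p.1, p.2.toNNReal), min p.2 0), by
    rcases le_total p.2 0 with h | h
    · exact .inr ⟨(heC _).2 (Real.toNNReal_eq_zero.2 h), min_le_right _ _⟩
    · exact .inl (min_eq_right h)⟩

theorem range_collarChart {C : Set X} {e : ℝ × NNReal → X} (heC : ∀ p, e p ∈ C ↔ p.2 = 0) :
    range (collarChart e heC) = {y | y.1.1 ∈ range e} := by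
  ext y
  constructor
  · rintro ⟨p, rfl⟩
    exact mem_range_self _
  · rcases y with ⟨⟨x, v⟩, hy⟩
    rintro ⟨⟨t, u⟩, rfl⟩
    rcases hy with hy | ⟨hC, hv⟩
    · simp only at hy
      subst hy
      exact ⟨(t, u), Subtype.ext (by simp [collarChart])⟩
    · simp only at hv hC
      have hu : u = 0 := (heC _).1 hC
      subst hu
      exact ⟨(t, v), Subtype.ext (by simp [collarChart, hv, Real.toNNReal_of_nonpos hv])⟩

theorem isOpenEmbedding_collarChart [TopologicalSpace X] {C : Set X} {e : ℝ × NNReal → X} (he : IsOpenEmbedding e)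
    (heC : ∀ p, e p ∈ C ↔ p.2 = 0) : IsOpenEmbedding (collarChart e heC) := by
  let ι : ℝ × ℝ → (ℝ × NNReal) × ℝ := fun p => ((p.1, p.2.toNNReal), min p.2 0)
  have hι : IsEmbedding ι := by
    refine .of_leftInverse (f := fun q => (q.1.1, (q.1.2 : ℝ) + q.2)) ?_ (by fun_prop)
      (by fun_prop)
    rintro ⟨t, s⟩
    rcases le_total s 0 with h | h <;> simp [ι, h]
  have h1 : IsEmbedding (Prod.map e (id : ℝ → ℝ) ∘ ι) :=
    (he.isEmbedding.prodMap IsEmbedding.id).comp hι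
  have h2 : IsEmbedding (collarChart e heC) :=
    .of_comp (h1.continuous.subtype_mk _) continuous_subtype_val h1
  refine ⟨h2, ?_⟩
  rw [range_collarChart]
  exact he.isOpen_range.preimage (continuous_fst.comp continuous_subtype_val)

theorem collarChart_le_iff {C : Set X} {e : ℝ × NNReal → X} (heC : ∀ p, e p ∈ C ↔ p.2 = 0)
    {f : X → ℝ} (hf : ∀ x, 0 ≤ f x) (t s : ℝ) :
    - f (collarChart e heC (t, s)).1.1 ≤ (collarChart e heC (t, s)).1.2 ↔ - f (e (t, 0)) ≤ s := by
  rcases le_total s 0 with h | h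
  · simp [collarChart, h, Real.toNNReal_of_nonpos h]
  · simp only [collarChart, h, min_eq_right, Left.neg_nonpos_iff, hf, true_iff]
    linarith [hf (e (t, 0))]

/-- A tent function. -/
def tent (r : ℝ) : ℝ := max 0 (1 - |r| / 2)

theorem lipschitzWith_tent : LipschitzWith (1 / 2) tent := by
  refine LipschitzWith.of_dist_le_mul fun x y => ?_
  rw [Real.dist_eq, Real.dist_eq]
  have h1 : |tent x - tent y| ≤ |(1 - |x| / 2) - (1 - |y| / 2)| := by
    have := abs_max_sub_max_le_abs (1 - |x| / 2) (1 - |y| / 2) 0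
    rwa [max_comm _ (0 : ℝ), max_comm _ (0 : ℝ)] at this
  have h2 := abs_abs_sub_abs_le_abs_sub x y
  have h3 : (1 - |x| / 2) - (1 - |y| / 2) = - ((|x| - |y|) / 2) := by ring
  rw [h3, abs_neg, abs_div, abs_two] at h1
  push_cast
  linarith

variable [TopologicalSpace X] [T2Space X]

theorem exists_collar_shift {C : Set X} {e : ℝ × NNReal → X} (he : IsOpenEmbedding e)
    (heC : ∀ p, e p ∈ C ↔ p.2 = 0) {f l : X → ℝ} (hf : Continuous f) (hf0 : ∀ x, 0 ≤ f x)
    (hl : Continuous l) (hl0 : ∀ x, 0 ≤ l x) (hl1 : ∀ x, l x ≤ 1) {K : Set X} (hK : IsCompact K)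
    (hKe : K ⊆ range e) (hlK : ∀ x ∉ K, l x = 0) :
    ∃ Ψ : CollarExt C ≃ₜ CollarExt C,
      (∀ y, - f (Ψ y).1.1 ≤ (Ψ y).1.2 ↔ - (f y.1.1 + l y.1.1) ≤ y.1.2) ∧
      (∀ y, y.1.1 ∈ C → y.1.2 = - (f y.1.1 + l y.1.1) → (Ψ y).1 = (y.1.1, - f y.1.1)) := by
  let F : ℝ → ℝ := fun t => f (e (t, 0))
  let lam : ℝ → ℝ := fun t => l (e (t, 0))
  have hFc : Continuous F := hf.comp (he.continuous.comp (by fun_prop))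
  have hlc : Continuous lam := hl.comp (he.continuous.comp (by fun_prop))
  have htc : Continuous tent := lipschitzWith_tent.continuous
  let g : ℝ × ℝ → ℝ × ℝ := fun p => (p.1, p.2 + - (lam p.1 * tent (p.2 + F p.1)))
  have hg : Continuous g := by fun_prop
  have hbij : ∀ t, Function.Bijective fun s => s + - (lam t * tent (s + F t)) := by
    intro t
    refine bijective_add_of_lipschitz (c := 1 / 2) (LipschitzWith.of_dist_le_mul fun x y => ?_) ?_
    · have := lipschitzWith_tent.dist_le_mul (x + F t) (y + F t)
      rw [Real.dist_eq, Real.dist_eq] at *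
      have h1 : - (lam t * tent (x + F t)) - - (lam t * tent (y + F t)) =
        - (lam t * (tent (x + F t) - tent (y + F t))) := by ring
      rw [h1, abs_neg, abs_mul, abs_of_nonneg (hl0 _)]
      have h2 : x + F t - (y + F t) = x - y := by ring
      rw [h2] at this
      calc _ ≤ 1 * |tent (x + F t) - tent (y + F t)| := by gcongr; exact hl1 _
        _ ≤ _ := by rw [one_mul]; exact this
    · rw [← NNReal.coe_lt_coe]; push_cast; norm_num
  have hmono : ∀ t s s', s ≤ s' ↔
      s + - (lam t * tent (s + F t)) ≤ s' + - (lam t * tent (s' + F t)) := by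
    intro t
    have hm : Monotone fun s => s + - (lam t * tent (s + F t)) := by
      intro x y hxy
      have := lipschitzWith_tent.dist_le_mul (x + F t) (y + F t)
      rw [Real.dist_eq, Real.dist_eq] at this
      have h2 : x + F t - (y + F t) = x - y := by ring
      rw [h2, abs_sub_comm x y, abs_of_nonneg (sub_nonneg.2 hxy)] at this
      push_cast at this
      have h3 := neg_le_of_abs_le this
      have h4 := hl0 (e (t, 0))
      have h5 := hl1 (e (t, 0))
      change x + - (lam t * tent (x + F t)) ≤ y + - (lam t * tent (y + F t))
      have h6 : lam t * (tent (y + F t) - tent (x + F t)) ≤ lam t * (1 / 2 * (y - x)) := by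
        refine mul_le_mul_of_nonneg_left ?_ h4
        linarith
      have h7 : lam t * (1 / 2 * (y - x)) ≤ 1 * (1 / 2 * (y - x)) := by
        refine mul_le_mul_of_nonneg_right h5 ?_
        linarith
      linarith
    have := hm.strictMono_of_injective (hbij t).injective
    exact fun s s' => this.le_iff_le.symm
  have hgb : Function.Bijective g := by
    constructor
    · rintro ⟨t, s⟩ ⟨t', s'⟩ h
      simp only [g, Prod.mk.injEq] at h
      obtain ⟨rfl, h⟩ := h
      exact Prod.ext rfl ((hbij t).injective h)
    · rintro ⟨t, s⟩
      obtain ⟨s', h⟩ := (hbij t).surjective s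
      exact ⟨(t, s'), Prod.ext rfl h⟩
  let T : Set ℝ := Prod.fst '' (e ⁻¹' K)
  have hT : IsCompact T := (he.isEmbedding.isInducing.isCompact_preimage' hK hKe).image
    continuous_fst
  let J : Set (ℝ × ℝ) := (fun q : ℝ × ℝ => (q.1, q.2 - F q.1)) '' (T ×ˢ Icc (-2) 2)
  have hJ : IsCompact J := (hT.prod isCompact_Icc).image (by fun_prop)
  obtain ⟨Ψ, hΨ, hΨid⟩ := exists_homeomorph_extend (isOpenEmbedding_collarChart he heC) hg hgb hJ (by
    rintro ⟨t, s⟩ hts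
    have : lam t * tent (s + F t) = 0 := by
      by_contra h
      apply hts
      refine ⟨(t, s + F t), ⟨⟨(t, 0), ?_, rfl⟩, ?_⟩, by simp⟩
      · by_contra hK
        exact h (by simp [lam, hlK _ hK])
      · by_contra h'
        apply h
        have : tent (s + F t) = 0 := by
          apply max_eq_left
          have : 2 < |s + F t| := by
            by_contra h2
            exact h' (abs_le.1 (not_lt.1 h2))
          linarith
        rw [this, mul_zero]
    simp [g, this])
  have hfix : ∀ y : CollarExt C, y.1.1 ∉ range e → Ψ.symm y = y ∧ l y.1.1 = 0 := by
    intro y hy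
    constructor
    · rw [Ψ.symm_apply_eq, hΨid]
      rintro ⟨p, -, rfl⟩
      exact hy (mem_range_self _)
    · exact hlK _ fun h => hy (hKe h)
  have hcase : ∀ y : CollarExt C, y.1.1 ∈ range e → ∃ t s, y = Ψ (collarChart e heC (t, s)) := by
    intro y hy
    have : y ∈ range (collarChart e heC) := by rw [range_collarChart]; exact hy
    obtain ⟨p, rfl⟩ := this
    obtain ⟨⟨t, s⟩, rfl⟩ := hgb.surjective p
    exact ⟨t, s, (hΨ _).symm⟩
  refine ⟨Ψ.symm, fun y => ?_, fun y => ?_⟩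
  on_goal 2 =>
    suffices h : (Ψ.symm y).1.1 = y.1.1 ∧ (Ψ.symm y).1.2 = - f y.1.1 ∨ ¬ (y.1.1 ∈ C ∧
        y.1.2 = - (f y.1.1 + l y.1.1)) from fun h1 h2 =>
      (h.resolve_right (not_not.2 ⟨h1, h2⟩)).elim Prod.ext
  · by_cases hy : y.1.1 ∈ range e
    · obtain ⟨t, s, rfl⟩ := hcase y hy
      rw [Ψ.symm_apply_apply, collarChart_le_iff heC hf0, hΨ]
      have h1 := collarChart_le_iff heC (f := fun x => f x + l x)
        (fun x => add_nonneg (hf0 x) (hl0 x)) (g (t, s)).1 (g (t, s)).2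
      refine Iff.trans ?_ h1.symm
      rw [hmono t]
      have h2 : tent (- f (e (t, 0)) + F t) = 1 := by simp [F, tent]
      rw [h2]
      change - F t + - (lam t * 1) ≤ _ ↔ - (F t + lam t) ≤ _
      rw [mul_one, neg_add]
    · rw [(hfix y hy).1, (hfix y hy).2, add_zero]
  · by_cases hy : y.1.1 ∈ range e
    · obtain ⟨t, s, rfl⟩ := hcase y hy
      rw [Ψ.symm_apply_apply, hΨ]
      by_cases h : (g (t, s)).2 ≤ 0
      · have h0 : (collarChart e heC (g (t, s))).1 = (e (t, 0), (g (t, s)).2) := by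
          refine Prod.ext ?_ (min_eq_left h)
          change e (t, (g (t, s)).2.toNNReal) = _
          rw [Real.toNNReal_of_nonpos h]
        by_cases h1 : (g (t, s)).2 = - (F t + lam t)
        · left
          have h2 : s = - F t := by
            apply (hbij t).injective
            change (g (t, s)).2 = _
            have h2 : tent (- F t + F t) = 1 := by simp [tent]
            simp only [h1, h2]
            ring
          have h3 : s ≤ 0 := by rw [h2]; exact neg_nonpos.2 (hf0 _)
          rw [h0]
          refine ⟨?_, ?_⟩
          · change e (t, s.toNNReal) = _
            rw [Real.toNNReal_of_nonpos h3]
          · change min s 0 = - F t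
            rw [min_eq_left h3, h2]
        · right
          rw [h0]
          exact fun h' => h1 h'.2
      · have h1 : 0 < (g (t, s)).2 := not_le.1 h
        right
        rintro ⟨h2, -⟩
        rw [show (collarChart e heC (g (t, s))).1.1 = e (t, (g (t, s)).2.toNNReal) from rfl,
          heC] at h2
        exact h (Real.toNNReal_eq_zero.1 h2)
    · rw [(hfix y hy).1]
      by_cases h : y.1.2 = - f y.1.1
      · exact .inl ⟨rfl, h⟩
      · right
        rw [(hfix y hy).2, add_zero]
        exact fun h' => h h'.2

theorem exists_collar_ext [LocallyCompactSpace X] {C : Set X} (hC : IsCompact C)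
    (hCe : IsLocallyEdge C) :
    ∃ f : X → ℝ, Continuous f ∧ (∀ x, 0 ≤ f x) ∧ (∀ c ∈ C, 0 < f c) ∧
    ∃ Θ : CollarExt C ≃ₜ CollarExt C,
      (∀ y, (Θ y).1.2 = 0 ↔ - f y.1.1 ≤ y.1.2) ∧
      (∀ y, y.1.1 ∈ C → y.1.2 = - f y.1.1 → (Θ y).1 = (y.1.1, 0)) := by
  choose! e he he0 heC using hCe
  have hl : ∀ c : X, ∃ l : C(X, ℝ), c ∈ C → l c = 1 ∧ IsCompact (tsupport l) ∧
      tsupport l ⊆ range (e c) ∧ ∀ x, l x ∈ Icc (0 : ℝ) 1 := by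
    intro c
    by_cases hc : c ∈ C
    · obtain ⟨l, h1, h2, h3, h4⟩ := exists_continuousMap_one_of_isCompact_subset_isOpen
        (isCompact_singleton (x := c)) (he c hc).isOpen_range
        (singleton_subset_iff.2 ⟨_, he0 c hc⟩)
      exact ⟨l, fun _ => ⟨h1 rfl, h2, h3, h4⟩⟩
    · exact ⟨0, fun h => absurd h hc⟩
  choose l hl using hl
  obtain ⟨I, hIC, hI⟩ := hC.elim_nhds_subcover (fun c => {x | 0 < l c x}) (fun c hc =>
    (isOpen_lt continuous_const (l c).continuous).mem_nhds (by simp [(hl c hc).1]))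
  have hsum : ∀ J : Finset X, (∀ c ∈ J, c ∈ C) →
      ∃ Θ : CollarExt C ≃ₜ CollarExt C,
      (∀ y, (Θ y).1.2 = 0 ↔ - (∑ c ∈ J, l c y.1.1) ≤ y.1.2) ∧
      (∀ y, y.1.1 ∈ C → y.1.2 = - (∑ c ∈ J, l c y.1.1) → (Θ y).1 = (y.1.1, 0)) := by
    classical
    intro J
    induction J using Finset.induction_on with
    | empty =>
      intro _
      refine ⟨Homeomorph.refl _, fun y => ?_, fun y _ hy => Prod.ext rfl (by simpa using hy)⟩
      have : y.1.2 ≤ 0 := by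
        rcases y.2 with h | h
        · exact h.le
        · exact h.2
      simp only [Homeomorph.refl_apply, id, Finset.sum_empty, neg_zero]
      exact ⟨fun h => h.ge, fun h => le_antisymm this h⟩
    | insert c J hcJ ih =>
      intro hJ
      obtain ⟨Θ, h1, h2⟩ := ih fun d hd => hJ d (Finset.mem_insert_of_mem hd)
      have hc := hJ c (Finset.mem_insert_self _ _)
      obtain ⟨-, hc2, hc3, hc4⟩ := hl c hc
      obtain ⟨Ψ, h3, h4⟩ := exists_collar_shift (C := C) (he c hc) (heC c hc)
        (f := fun x => ∑ d ∈ J, l d x) (l := l c) (by fun_prop)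
        (fun x => Finset.sum_nonneg fun d hd =>
          ((hl d (hJ d (Finset.mem_insert_of_mem hd))).2.2.2 x).1)
        (l c).continuous (fun x => (hc4 x).1) (fun x => (hc4 x).2) hc2 hc3
        (fun x hx => image_eq_zero_of_notMem_tsupport hx)
      refine ⟨Ψ.trans Θ, fun y => ?_, fun y hy hv => ?_⟩
      · rw [Homeomorph.trans_apply, h1, h3, Finset.sum_insert hcJ, add_comm (l c _)]
      · rw [Finset.sum_insert hcJ, add_comm (l c _)] at hv
        have h5 := h4 y hy hv
        rw [Homeomorph.trans_apply, h2 (Ψ y) (by rw [h5]; exact hy) (by rw [h5]), h5]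
  obtain ⟨Θ, h1, h2⟩ := hsum I hIC
  refine ⟨fun x => ∑ c ∈ I, l c x, by fun_prop, fun x => Finset.sum_nonneg fun d hd =>
    ((hl d (hIC d hd)).2.2.2 x).1, fun x hx => ?_, Θ, h1, h2⟩
  obtain ⟨c, hc, hxc⟩ := mem_iUnion₂.1 (hI hx)
  exact Finset.sum_pos' (fun d hd => ((hl d (hIC d hd)).2.2.2 x).1) ⟨c, hc, hxc⟩

/-- Existence of collars. -/
theorem exists_collar [LocallyCompactSpace X] {C : Set X} (hC : IsCompact C)
    (hCe : IsLocallyEdge C) {O : Set X} (hO : IsOpen O) (hCO : C ⊆ O) :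
    ∃ k : C × NNReal → X, IsOpenEmbedding k ∧ (∀ c, k (c, 0) = c) ∧ range k ⊆ O := by
  suffices h : ∃ k : C × NNReal → X, IsOpenEmbedding k ∧ (∀ c, k (c, 0) = c) by
    obtain ⟨k, hk, hk0⟩ := h
    have : CompactSpace C := isCompact_iff_compactSpace.1 hC
    obtain ⟨u, v, -, hv, hu, h0v, huv⟩ := generalized_tube_lemma (s := (univ : Set C))
      isCompact_univ (t := {(0 : NNReal)}) isCompact_singleton (n := k ⁻¹' O)
      (hO.preimage hk.continuous) (by
        rintro ⟨c, s⟩ ⟨-, hs⟩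
        rw [mem_singleton_iff] at hs
        simp only at hs
        subst hs
        rw [mem_preimage, hk0]
        exact hCO c.2)
    obtain ⟨r, hr, hrv⟩ := Metric.mem_nhds_iff.1 (hv.mem_nhds (h0v rfl))
    obtain ⟨σ, hσ, hσ0, hσr⟩ := exists_squeeze_nnreal (r := ⟨r, hr.le⟩) (by exact_mod_cast hr)
    refine ⟨k ∘ Prod.map id σ, hk.comp (IsOpenEmbedding.id.prodMap hσ), fun c => by simp [hσ0, hk0],
      ?_⟩
    rintro _ ⟨⟨c, s⟩, rfl⟩
    refine huv ⟨hu (mem_univ _), hrv ?_⟩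
    have h1 : ((σ s : NNReal) : ℝ) < r := by exact_mod_cast hσr s
    rw [Metric.mem_ball, NNReal.dist_eq]
    simpa [abs_of_nonneg] using h1
  obtain ⟨f, hf, hf0, hfC, Θ, h1, h2⟩ := exists_collar_ext hC hCe
  let R : X → CollarExt C := fun x => Θ.symm ⟨(x, 0), .inl rfl⟩
  have hRc : Continuous R := Θ.symm.continuous.comp
    (Continuous.subtype_mk (by fun_prop) _)
  let τ : NNReal → ℝ := fun s => - Real.exp (-(s : ℝ))
  have hτneg : ∀ s, τ s < 0 := fun s => neg_lt_zero.2 (Real.exp_pos _)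
  have hτc : Continuous τ := by fun_prop
  have hτ : IsEmbedding τ := by
    have h1 : IsEmbedding (fun x : ℝ => - Real.exp (-x)) :=
      (Homeomorph.neg ℝ).isEmbedding.comp
        (Real.isOpenEmbedding_exp.isEmbedding.comp (Homeomorph.neg ℝ).isEmbedding)
    exact h1.comp NNReal.isEmbedding_coe
  let j : C × NNReal → CollarExt C := fun q => ⟨(q.1, f q.1 * τ q.2), .inr ⟨q.1.2,
    mul_nonpos_of_nonneg_of_nonpos (hf0 _) (hτneg _).le⟩⟩
  have hjc : Continuous j := by
    refine Continuous.subtype_mk ?_ _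
    fun_prop
  have hj : IsEmbedding j := by
    let A : C × ℝ → C × ℝ := fun q => (q.1, f q.1 * q.2)
    have hA : IsEmbedding A := by
      refine .of_leftInverse (f := fun q => (q.1, q.2 / f q.1)) ?_ ?_ (by fun_prop)
      · rintro ⟨c, v⟩
        have := (hfC c c.2).ne'
        simp only [A, Prod.mk.injEq, true_and]
        field_simp
      · exact continuous_fst.prodMk (continuous_snd.div₀ (by fun_prop)
          fun q => (hfC _ q.1.2).ne')
    have h3 : IsEmbedding (Prod.map ((↑) : C → X) (id : ℝ → ℝ) ∘ A ∘ Prod.map id τ) :=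
      (IsEmbedding.subtypeVal.prodMap IsEmbedding.id).comp
        (hA.comp (IsEmbedding.id.prodMap hτ))
    exact .of_comp hjc continuous_subtype_val h3
  have hΘj : ∀ q, (Θ (j q)).1.2 = 0 := by
    intro q
    rw [h1]
    have h3 : -1 ≤ τ q.2 := neg_le_neg (Real.exp_le_one_iff.2 (neg_nonpos.2 q.2.2))
    change - f q.1 ≤ f q.1 * τ q.2
    nlinarith [hf0 q.1]
  let k : C × NNReal → X := fun q => (Θ (j q)).1.1
  have hkc : Continuous k :=
    continuous_fst.comp (continuous_subtype_val.comp (Θ.continuous.comp hjc))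
  have hRk : R ∘ k = j := by
    funext q
    rw [Function.comp_apply, Θ.symm_apply_eq]
    exact Subtype.ext (Prod.ext rfl (hΘj q).symm)
  have hrange : range k = {x | (R x).1.2 < 0} := by
    ext x
    constructor
    · rintro ⟨q, rfl⟩
      change ((R ∘ k) q).1.2 < 0
      rw [hRk]
      exact mul_neg_of_pos_of_neg (hfC _ q.1.2) (hτneg _)
    · intro (hx : (R x).1.2 < 0)
      have hC' : (R x).1.1 ∈ C := by
        rcases (R x).2 with h | h
        · exact absurd h hx.ne
        · exact h.1
      have h3 : - f (R x).1.1 ≤ (R x).1.2 := by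
        rw [← h1]
        simp [R]
      have hfp := hfC _ hC'
      set c := (R x).1.1
      set v := (R x).1.2
      have h4 : 0 < -v / f c := div_pos (neg_pos.2 hx) hfp
      have h5 : -v / f c ≤ 1 := by rw [div_le_one hfp]; linarith
      refine ⟨(⟨c, hC'⟩, ⟨- Real.log (-v / f c), neg_nonneg.2 (Real.log_nonpos h4.le h5)⟩), ?_⟩
      have h6 : j (⟨c, hC'⟩, ⟨- Real.log (-v / f c), neg_nonneg.2 (Real.log_nonpos h4.le h5)⟩) =
          R x := by
        refine Subtype.ext (Prod.ext rfl ?_)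
        change f c * - Real.exp (- - Real.log (-v / f c)) = v
        rw [neg_neg, Real.exp_log h4]
        field_simp
      change (Θ (j _)).1.1 = x
      rw [h6]
      simp [R]
  refine ⟨k, ⟨.of_comp hkc hRc (hRk ▸ hj), ?_⟩, fun c => ?_⟩
  · rw [hrange]
    exact isOpen_lt (continuous_snd.comp (continuous_subtype_val.comp hRc)) continuous_const
  · have := h2 (j (c, 0)) c.2 (by simp [j, τ])
    change (Θ (j (c, 0))).1.1 = c
    rw [this]

end Collar

end

section

/-- The König lemma for infinite connected locally finite graphs. -/
theorem SimpleGraph.exists_injective_ray {V : Type*} [Infinite V] (G : SimpleGraph V)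
    (hG : G.Connected) (hfin : ∀ v, (G.neighborSet v).Finite) (v₀ : V) :
    ∃ j : ℕ → V, j 0 = v₀ ∧ Function.Injective j ∧ ∀ i, G.Adj (j i) (j (i + 1)) := by
  let D : V → Set V := fun v => {x | G.dist v₀ x = G.dist v₀ v + G.dist v x}
  have hstep : ∀ v, (D v).Infinite → ∃ w, G.Adj v w ∧ G.dist v₀ w = G.dist v₀ v + 1 ∧
      (D w).Infinite := by
    intro v hv
    by_contra! hcon
    apply hv
    have hsub : D v ⊆ {v} ∪ ⋃ w ∈ {w ∈ G.neighborSet v | G.dist v₀ w = G.dist v₀ v + 1}, D w := by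
      intro x (hx : _ = _)
      obtain ⟨p, hp⟩ := hG.exists_walk_length_eq_dist v x
      cases p with
      | nil => exact .inl rfl
      | @cons _ w _ h p =>
        right
        have h1 := G.dist_le p
        rw [SimpleGraph.Walk.length_cons] at hp
        have h2 := hG.dist_triangle (u := v₀) (v := w) (w := x)
        have h3 := hG.dist_triangle (u := v₀) (v := v) (w := w)
        rw [SimpleGraph.dist_eq_one_iff_adj.2 h] at h3
        refine mem_iUnion₂.2 ⟨w, ⟨h, by omega⟩, ?_⟩
        change _ = _
        omega
    refine ((finite_singleton v).union (((hfin v).subset (sep_subset _ _)).biUnion ?_)).subset hsub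
    rintro w ⟨hw, hd⟩
    exact hcon w hw hd
  have h0 : (D v₀).Infinite := by
    have : D v₀ = univ := by ext x; simp [D]
    rw [this]
    exact infinite_univ
  choose! nxt h1 h2 h3 using hstep
  let j : ℕ → V := fun i => nxt^[i] v₀
  have hj : ∀ i, j (i + 1) = nxt (j i) := fun i => Function.iterate_succ_apply' _ _ _
  have hD : ∀ i, (D (j i)).Infinite := by
    intro i
    induction i with
    | zero => exact h0
    | succ i ih => rw [hj]; exact h3 _ ih
  have hdist : ∀ i, G.dist v₀ (j i) = i := by
    intro i
    induction i with
    | zero => simp [j]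
    | succ i ih => rw [hj, h2 _ (hD i), ih]
  refine ⟨j, rfl, fun a b hab => ?_, fun i => ?_⟩
  · rw [← hdist a, ← hdist b, hab]
  · rw [hj]; exact h1 _ (hD i)

section Push

universe u

variable {M : Type u} [TopologicalSpace M]

theorem exists_good_cover [T2Space M] [LocallyCompactSpace M] [SigmaCompactSpace M]
    (hM : ∀ x : M, IsPlanar x ∨ IsEdge x) :
    ∃ (α : Type u) (W : α → Set M), LocallyFinite W ∧ (⋃ a, W a = univ) ∧ ∀ a, IsOpen (W a) ∧
      (∃ K, IsCompact K ∧ W a ⊆ K) ∧ IsPreconnected (W a ∩ {y | IsPlanar y}) ∧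
      (W a ∩ {y | IsPlanar y}).Nonempty := by
  have hB : ∀ x : M, (𝓝 x).HasBasis (fun W => x ∈ W ∧ IsOpen W ∧
      (∃ K, IsCompact K ∧ W ⊆ K) ∧ IsPreconnected (W ∩ {y | IsPlanar y}) ∧
      (W ∩ {y | IsPlanar y}).Nonempty) (fun W => W) := by
    refine fun x => hasBasis_iff.2 fun O => ⟨fun hO => ?_, ?_⟩
    · obtain ⟨K, hK, hKO, hKc⟩ := LocallyCompactSpace.local_compact_nhds x O hO
      obtain ⟨W, hWK, hxW, hWo, -, hWP, hWn⟩ := exists_good_nhd hM hK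
      exact ⟨W, ⟨hxW, hWo, ⟨K, hKc, hWK⟩, hWP, hWn⟩, hWK.trans hKO⟩
    · rintro ⟨W, ⟨hxW, hWo, -⟩, hWO⟩
      exact mem_of_superset (hWo.mem_nhds hxW) hWO
  obtain ⟨α, c, r, h1, h2, h3⟩ := refinement_of_locallyCompact_sigmaCompact_of_nhds_basis hB
  exact ⟨α, r, h3, h2, fun a => (h1 a).2⟩

theorem exists_injective_chain [PreconnectedSpace M] (hnc : ¬ CompactSpace M) {α : Type*}
    {W : α → Set M} (hlf : LocallyFinite W) (hcov : ⋃ a, W a = univ) (hWo : ∀ a, IsOpen (W a))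
    (hWK : ∀ a, ∃ K, IsCompact K ∧ W a ⊆ K) (hWn : ∀ a, (W a).Nonempty) (a₀ : α) :
    ∃ j : ℕ → α, j 0 = a₀ ∧ Function.Injective j ∧ ∀ i, (W (j i) ∩ W (j (i + 1))).Nonempty := by
  let G : SimpleGraph α := SimpleGraph.fromRel fun a b => (W a ∩ W b).Nonempty
  have hadj : ∀ a b, G.Adj a b → (W a ∩ W b).Nonempty := by
    rintro a b ⟨-, h | h⟩
    · exact h
    · rwa [inter_comm]
  have hinf : Infinite α := by
    by_contra hfin
    rw [not_infinite_iff_finite] at hfin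
    choose K hK hWK using hWK
    refine hnc ⟨(isCompact_iUnion hK).of_isClosed_subset isClosed_univ ?_⟩
    rw [← hcov]
    exact iUnion_mono hWK
  have hconn : G.Connected := by
    have : Nonempty α := ⟨a₀⟩
    refine (SimpleGraph.connected_iff_exists_forall_reachable G).2 ⟨a₀, fun b => ?_⟩
    by_contra hb
    have := isPreconnected_univ (α := M)
    obtain ⟨x, -, hx1, hx2⟩ := this (⋃ a ∈ {a | G.Reachable a₀ a}, W a)
      (⋃ a ∈ {a | ¬ G.Reachable a₀ a}, W a)
      (isOpen_biUnion fun a _ => hWo a) (isOpen_biUnion fun a _ => hWo a) (by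
        intro x _
        obtain ⟨a, ha⟩ := mem_iUnion.1 (hcov ▸ mem_univ x : x ∈ ⋃ a, W a)
        by_cases h : G.Reachable a₀ a
        · exact .inl (mem_biUnion h ha)
        · exact .inr (mem_biUnion (show a ∈ {a | ¬ G.Reachable a₀ a} from h) ha))
      (by
        obtain ⟨x, hx⟩ := hWn a₀
        exact ⟨x, mem_univ _, mem_biUnion (SimpleGraph.Reachable.refl a₀) hx⟩)
      (by
        obtain ⟨x, hx⟩ := hWn b
        exact ⟨x, mem_univ _, mem_biUnion (show b ∈ {a | ¬ G.Reachable a₀ a} from hb) hx⟩)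
    obtain ⟨a, ha, hxa⟩ := mem_iUnion₂.1 hx1
    obtain ⟨a', ha', hxa'⟩ := mem_iUnion₂.1 hx2
    apply ha'
    by_cases h : a = a'
    · exact h ▸ ha
    · exact SimpleGraph.Reachable.trans ha
        (SimpleGraph.Adj.reachable ⟨h, .inl ⟨x, hxa, hxa'⟩⟩)
  have hfin : ∀ a, (G.neighborSet a).Finite := by
    intro a
    obtain ⟨K, hK, hWK⟩ := hWK a
    refine (hlf.finite_nonempty_inter_compact hK).subset fun b hb => ?_
    obtain ⟨x, hx, hx'⟩ := hadj a b hb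
    exact ⟨x, hx', hWK hx⟩
  obtain ⟨j, h0, hj, hj'⟩ := G.exists_injective_ray hconn hfin a₀
  exact ⟨j, h0, hj, fun i => hadj _ _ (hj' i)⟩

/-- On a noncompact connected surface an isolated zero of a continuous function may be pushed
to infinity. -/
theorem exists_push_zero [T2Space M] [LocallyCompactSpace M] [SigmaCompactSpace M]
    [PreconnectedSpace M] (hM : ∀ x : M, IsPlanar x ∨ IsEdge x)
    (hnc : ¬ CompactSpace M) {v : M → ℂ} (hv : Continuous v) {q₀ : M} (hq₀ : IsPlanar q₀)
    (hv0 : ∀ x, v x = 0 → x = q₀) :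
    ∃ u : M → ℂ, Continuous u ∧ (∀ x, u x ≠ 0) ∧ ∀ x, ¬ IsPlanar x → u x = v x := by
  obtain ⟨α, W, hlf, hcov, hW⟩ := exists_good_cover hM
  obtain ⟨a₀, ha₀⟩ := mem_iUnion.1 (hcov ▸ mem_univ q₀ : q₀ ∈ ⋃ a, W a)
  obtain ⟨j, hj0, hj, hjW⟩ := exists_injective_chain hnc hlf hcov (fun a => (hW a).1)
    (fun a => (hW a).2.1) (fun a => (hW a).2.2.2.mono inter_subset_left) a₀
  have hq : ∀ i, ∃ q ∈ W (j i) ∩ W (j (i + 1)), IsPlanar q := fun i => by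
    obtain ⟨q, h1, h2⟩ := (dense_isPlanar hM).inter_open_nonempty _
      ((hW (j i)).1.inter (hW (j (i + 1))).1) (hjW i)
    exact ⟨q, h1, h2⟩
  choose r hrW hrP using hq
  let q : ℕ → M := fun i => Nat.casesOn i q₀ r
  have hqW : ∀ i, q i ∈ W (j i) ∩ {y | IsPlanar y} := by
    rintro (_ | i)
    · exact ⟨hj0 ▸ ha₀, hq₀⟩
    · exact ⟨(hrW i).2, hrP i⟩
  have hΘ : ∀ i, ∃ Θ : M ≃ₜ M, Θ (q i) = q (i + 1) ∧ ∃ K ⊆ W (j i) ∩ {y | IsPlanar y},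
      IsCompact K ∧ ∀ z ∉ K, Θ z = z := fun i =>
    exists_homeomorph_map_eq ((hW _).1.inter isOpen_isPlanar) (hW _).2.2.1 (fun x hx => hx.2)
      (hqW i) ⟨(hrW i).1, hrP i⟩
  choose Θ hΘq K hKW _ hΘK using hΘ
  let f : ℕ → M → ℂ := fun n => Nat.rec v (fun i g => g ∘ (Θ i).symm) n
  have hf : ∀ i x, f (i + 1) x = f i ((Θ i).symm x) := fun i x => rfl
  have hΘs : ∀ i, ∀ z ∉ K i, (Θ i).symm z = z := fun i z hz => by
    rw [(Θ i).symm_apply_eq, hΘK i z hz]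
  have hfc : ∀ n, Continuous (f n) := by
    intro n
    induction n with
    | zero => exact hv
    | succ n ih => exact ih.comp (Θ n).symm.continuous
  have hfz : ∀ n x, f n x = 0 → x = q n := by
    intro n
    induction n with
    | zero => exact hv0
    | succ n ih =>
      intro x hx
      have := ih _ hx
      rw [(Θ n).symm_apply_eq] at this
      rw [this, hΘq]
  have hfb : ∀ n x, ¬ IsPlanar x → f n x = v x := by
    intro n x hx
    induction n with
    | zero => rfl
    | succ n ih => rw [hf, hΘs n x (fun h => hx (hKW n h).2), ih]
  have hlfj : LocallyFinite fun n => W (j n) := hlf.comp_injective hj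
  have hlf' : LocallyFinite fun n => {x | f (n + 1) x ≠ f n x} := by
    refine hlfj.subset fun n x hx => ?_
    by_contra h
    exact hx (by rw [hf, hΘs n x (fun h' => h (hKW n h').1)])
  obtain ⟨u, hu⟩ := hlf'.exists_forall_eventually_atTop_eventuallyEq
  refine ⟨u, ?_, fun x hx => ?_, fun x hx => ?_⟩
  · rw [continuous_iff_continuousAt]
    intro x
    obtain ⟨n, hn⟩ := (hu x).exists
    exact (hfc n).continuousAt.congr hn
  · have h1 : ∀ᶠ n in atTop, x ∈ W (j n) := (hu x).mono fun n hn => by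
      have := hfz n x (hn.self_of_nhds.trans hx)
      rw [this]
      exact (hqW n).1
    obtain ⟨N, hN⟩ := eventually_atTop.1 h1
    exact (infinite_of_injective_forall_mem (add_left_injective N)
      (fun n => hN (n + N) (Nat.le_add_left _ _))) (hlfj.point_finite x)
  · obtain ⟨n, hn⟩ := (hu x).exists
    rw [← hn.self_of_nhds, hfb n x hx]

end Push

end

section

theorem Topology.IsOpenEmbedding.continuous_extend_const {X Y Z : Type*} [TopologicalSpace X]
    [T2Space X] [TopologicalSpace Y] [TopologicalSpace Z] {Φ : Y → X} (hΦ : IsOpenEmbedding Φ)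
    {l : Y → Z} (hl : Continuous l) {z : Z} {K : Set Y} (hK : IsCompact K) (hlK : ∀ y ∉ K, l y = z) :
    Continuous (Function.extend Φ l fun _ => z) := by
  rw [continuous_iff_continuousAt]
  intro x
  by_cases hx : x ∈ range Φ
  · obtain ⟨y, rfl⟩ := hx
    have h : Function.extend Φ l (fun _ => z) ∘ Φ = l :=
      funext fun y => hΦ.injective.extend_apply _ _ y
    rw [← hΦ.continuousAt_iff, h]
    exact hl.continuousAt
  · have hKc : IsClosed (Φ '' K) := (hK.image hΦ.continuous).isClosed
    have : x ∈ (Φ '' K)ᶜ := fun ⟨y, _, h⟩ => hx ⟨y, h⟩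
    refine (continuousAt_const (y := z)).congr (mem_of_superset (hKc.isOpen_compl.mem_nhds this) ?_)
    intro w hw
    change z = _
    by_cases h : w ∈ range Φ
    · obtain ⟨y, rfl⟩ := h
      rw [hΦ.injective.extend_apply, hlK y fun hy => hw ⟨y, hy, rfl⟩]
    · rw [Function.extend_apply' _ _ _ (by simpa using h)]

theorem isPlanar_of_map {X Y : Type*} [TopologicalSpace X] [TopologicalSpace Y] {f : X → Y}
    (hf : IsOpenEmbedding f) {x : X} (h : IsPlanar (f x)) : IsPlanar x := by
  obtain ⟨e, he, he0, hr⟩ := h.exists_subset (hf.isOpen_range.mem_nhds (mem_range_self x))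
  choose g hg using fun z => hr (mem_range_self z)
  refine ⟨g, ?_, hf.injective (by rw [hg, he0])⟩
  exact .of_comp g hf (by rwa [show f ∘ g = e from funext hg])

section Collapse

variable {M : Type*}

/-- The equivalence relation collapsing two disjoint sets to two points. -/
def collapseSetoid (C₁ C₂ : Set M) (hd : Disjoint C₁ C₂) : Setoid M where
  r x y := x = y ∨ (x ∈ C₁ ∧ y ∈ C₁) ∨ (x ∈ C₂ ∧ y ∈ C₂)
  iseqv :=
    { refl := fun x => .inl rfl
      symm := by
        rintro x y (h | h | h)
        · exact .inl h.symm
        · exact .inr (.inl h.symm)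
        · exact .inr (.inr h.symm)
      trans := by
        have := fun x (h : x ∈ C₁) (h' : x ∈ C₂) => disjoint_left.1 hd h h'
        grind }

/-- The space obtained by collapsing two disjoint sets to two points. -/
abbrev Collapse (C₁ C₂ : Set M) (hd : Disjoint C₁ C₂) : Type _ :=
  Quotient (collapseSetoid C₁ C₂ hd)

/-- The projection onto the collapsed space. -/
def collapseMk (C₁ C₂ : Set M) (hd : Disjoint C₁ C₂) (x : M) : Collapse C₁ C₂ hd :=
  Quotient.mk _ x

variable {C₁ C₂ : Set M} {hd : Disjoint C₁ C₂}

theorem collapseMk_eq_iff {x y : M} : collapseMk C₁ C₂ hd x = collapseMk C₁ C₂ hd y ↔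
    x = y ∨ (x ∈ C₁ ∧ y ∈ C₁) ∨ (x ∈ C₂ ∧ y ∈ C₂) :=
  Quotient.eq (r := collapseSetoid C₁ C₂ hd)

theorem collapseMk_eq_iff_of_notMem {x y : M} (h₁ : x ∉ C₁) (h₂ : x ∉ C₂) :
    collapseMk C₁ C₂ hd x = collapseMk C₁ C₂ hd y ↔ x = y := by
  rw [collapseMk_eq_iff]
  simp [h₁, h₂]

theorem surjective_collapseMk : Function.Surjective (collapseMk C₁ C₂ hd) := Quotient.mk_surjective

variable [TopologicalSpace M]

theorem isQuotientMap_collapseMk : IsQuotientMap (collapseMk C₁ C₂ hd) := isQuotientMap_quotient_mk'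

theorem t2Space_collapse [NormalSpace M] [T1Space M] (h₁ : IsClosed C₁) (h₂ : IsClosed C₂) :
    T2Space (Collapse C₁ C₂ hd) := by
  refine ⟨fun x' y' hne => ?_⟩
  obtain ⟨x, rfl⟩ := surjective_collapseMk x'
  obtain ⟨y, rfl⟩ := surjective_collapseMk y'
  have hdj : ∀ z, z ∈ C₁ → z ∈ C₂ → False := fun z h h' => disjoint_left.1 hd h h'
  rw [Ne, collapseMk_eq_iff] at hne
  obtain ⟨A, B, hA, hB, hAB, hxA, hyB, hC₁, hC₂⟩ : ∃ A B : Set M, IsClosed A ∧ IsClosed B ∧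
      Disjoint A B ∧ x ∈ A ∧ y ∈ B ∧ (C₁ ⊆ A ∨ C₁ ⊆ B) ∧ (C₂ ⊆ A ∨ C₂ ⊆ B) := by
    by_cases hy₁ : y ∈ C₁
    · refine ⟨{x} ∪ C₂, C₁, isClosed_singleton.union h₂, h₁, ?_, by simp, hy₁, by simp, by simp⟩
      rw [disjoint_left]
      rintro z (rfl | h) h'
      · exact hne (.inr (.inl ⟨h', hy₁⟩))
      · exact hdj z h' h
    by_cases hy₂ : y ∈ C₂
    · refine ⟨{x} ∪ C₁, C₂, isClosed_singleton.union h₁, h₂, ?_, by simp, hy₂, by simp, by simp⟩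
      rw [disjoint_left]
      rintro z (rfl | h) h'
      · exact hne (.inr (.inr ⟨h', hy₂⟩))
      · exact hdj z h h'
    · refine ⟨{x} ∪ (C₁ ∪ C₂), {y}, isClosed_singleton.union (h₁.union h₂), isClosed_singleton,
        ?_, by simp, by simp, .inl ?_, .inl ?_⟩
      · rw [disjoint_singleton_right]
        rintro (h | h | h)
        · exact hne (.inl h.symm)
        · exact hy₁ h
        · exact hy₂ h
      · exact subset_union_left.trans subset_union_right
      · exact subset_union_right.trans subset_union_right
  obtain ⟨f, hfA, hfB, -⟩ := exists_continuous_zero_one_of_isClosed hA hB hAB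
  have hconst : ∀ C, (C ⊆ A ∨ C ⊆ B) → ∀ a ∈ C, ∀ b ∈ C, f a = f b := by
    rintro C (h | h) a ha b hb
    · rw [hfA (h ha), hfA (h hb)]; rfl
    · rw [hfB (h ha), hfB (h hb)]; rfl
  let g : Collapse C₁ C₂ hd → ℝ := Quotient.lift f (by
    rintro a b (rfl | ⟨ha, hb⟩ | ⟨ha, hb⟩)
    · rfl
    · exact hconst _ hC₁ _ ha _ hb
    · exact hconst _ hC₂ _ ha _ hb)
  have hg : Continuous g := isQuotientMap_collapseMk.continuous_iff.2 f.continuous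
  refine separated_by_continuous hg ?_
  change f x ≠ f y
  rw [hfA hxA, hfB hyB]
  simp

theorem isProperMap_collapseMk (h₁ : IsCompact C₁) (h₂ : IsCompact C₂) [T2Space M] :
    IsProperMap (collapseMk C₁ C₂ hd) := by
  rw [isProperMap_iff_isClosedMap_and_compact_fibers]
  refine ⟨isQuotientMap_collapseMk.continuous, fun A hA => ?_, fun y => ?_⟩
  · rw [← isQuotientMap_collapseMk.isClosed_preimage]
    have : collapseMk C₁ C₂ hd ⁻¹' (collapseMk C₁ C₂ hd '' A) =
        A ∪ {x | x ∈ C₁ ∧ (A ∩ C₁).Nonempty} ∪ {x | x ∈ C₂ ∧ (A ∩ C₂).Nonempty} := by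
      ext x
      simp only [mem_preimage, mem_image, collapseMk_eq_iff, mem_union, mem_ofPred_eq]
      constructor
      · rintro ⟨y, hy, rfl | ⟨h, h'⟩ | ⟨h, h'⟩⟩
        · exact .inl (.inl hy)
        · exact .inl (.inr ⟨h', y, hy, h⟩)
        · exact .inr ⟨h', y, hy, h⟩
      · rintro ((h | ⟨h, y, hy, hy'⟩) | ⟨h, y, hy, hy'⟩)
        · exact ⟨x, h, .inl rfl⟩
        · exact ⟨y, hy, .inr (.inl ⟨hy', h⟩)⟩
        · exact ⟨y, hy, .inr (.inr ⟨hy', h⟩)⟩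
    rw [this]
    refine (hA.union ?_).union ?_
    · by_cases h : (A ∩ C₁).Nonempty
      · simpa [h] using h₁.isClosed
      · simp [h]
    · by_cases h : (A ∩ C₂).Nonempty
      · simpa [h] using h₂.isClosed
      · simp [h]
  · obtain ⟨y, rfl⟩ := surjective_collapseMk y
    have : collapseMk C₁ C₂ hd ⁻¹' {collapseMk C₁ C₂ hd y} =
        {y} ∪ {x | x ∈ C₁ ∧ y ∈ C₁} ∪ {x | x ∈ C₂ ∧ y ∈ C₂} := by
      ext x
      simp [collapseMk_eq_iff, or_assoc]
    rw [this]
    refine (isCompact_singleton.union ?_).union ?_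
    · by_cases h : y ∈ C₁ <;> simp [h, h₁]
    · by_cases h : y ∈ C₂ <;> simp [h, h₂]

theorem isOpenEmbedding_collapseMk (h₁ : IsClosed C₁) (h₂ : IsClosed C₂) :
    IsOpenEmbedding fun x : ↥(C₁ ∪ C₂)ᶜ => collapseMk C₁ C₂ hd x := by
  refine .of_continuous_injective_isOpenMap
    (isQuotientMap_collapseMk.continuous.comp continuous_subtype_val) ?_ ?_
  · rintro ⟨x, hx⟩ ⟨y, hy⟩ h
    simp only [mem_compl_iff, mem_union, not_or] at hx
    exact Subtype.ext ((collapseMk_eq_iff_of_notMem hx.1 hx.2).1 h)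
  · intro V hV
    have hV' : IsOpen ((↑) '' V : Set M) :=
      (h₁.union h₂).isOpen_compl.isOpenMap_subtype_val V hV
    rw [← isQuotientMap_collapseMk.isOpen_preimage]
    convert hV' using 1
    ext x
    constructor
    · rintro ⟨⟨y, hy⟩, hyV, h⟩
      simp only [mem_compl_iff, mem_union, not_or] at hy
      have := (collapseMk_eq_iff_of_notMem hy.1 hy.2).1 h
      exact ⟨_, hyV, this⟩
    · rintro ⟨y, hy, rfl⟩
      exact ⟨y, hy, rfl⟩

end Collapse

end

section

/-- The polar coordinates map from the half-infinite cylinder to the plane. -/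
def polarMap (p : Circle × NNReal) : ℂ := ((p.2 : ℝ) : ℂ) * (p.1 : ℂ)

theorem continuous_polarMap : Continuous polarMap := by
  unfold polarMap
  fun_prop

theorem norm_polarMap (p : Circle × NNReal) : ‖polarMap p‖ = p.2 := by
  rw [polarMap, norm_mul, Circle.norm_coe, mul_one, Complex.norm_of_nonneg p.2.coe_nonneg]

theorem surjective_polarMap : Function.Surjective polarMap := by
  intro z
  refine ⟨(Circle.exp z.arg, ‖z‖₊), ?_⟩
  simp [polarMap, Complex.norm_mul_exp_arg_mul_I]

theorem isQuotientMap_polarMap : IsQuotientMap polarMap := by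
  refine IsClosedMap.isQuotientMap ?_ continuous_polarMap surjective_polarMap
  refine (isProperMap_iff_isCompact_preimage.2 ⟨continuous_polarMap, fun K hK => ?_⟩).isClosedMap
  obtain ⟨R, hR⟩ := hK.isBounded.exists_norm_le
  refine (isCompact_univ.prod (isCompact_Icc (a := 0) (b := Real.toNNReal R))).of_isClosed_subset
    (hK.isClosed.preimage continuous_polarMap) ?_
  intro p hp
  refine ⟨mem_univ _, zero_le, ?_⟩
  rw [← NNReal.coe_le_coe, ← norm_polarMap]
  exact (hR _ hp).trans (Real.le_coe_toNNReal R)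

theorem polarMap_eq_iff {p p' : Circle × NNReal} :
    polarMap p = polarMap p' ↔ p = p' ∨ (p.2 = 0 ∧ p'.2 = 0) := by
  constructor
  · intro h
    have h2 : p.2 = p'.2 := by
      rw [← NNReal.coe_inj, ← norm_polarMap, ← norm_polarMap, h]
    by_cases h0 : p.2 = 0
    · exact .inr ⟨h0, h2 ▸ h0⟩
    · refine .inl (Prod.ext ?_ h2)
      simp only [polarMap, h2] at h
      have : ((p'.2 : ℝ) : ℂ) ≠ 0 := by
        rw [← h2]
        exact_mod_cast h0
      exact Circle.coe_injective (mul_left_cancel₀ this h)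
  · rintro (rfl | ⟨h, hs⟩)
    · rfl
    · simp [polarMap, h, hs]

/-- A parametrized collar of the circle `C`. -/
structure CircleCollar {M : Type*} [TopologicalSpace M] (C : Set M) (k : Circle × NNReal → M) :
    Prop where
  isOpenEmbedding : IsOpenEmbedding k
  mem_iff : ∀ p, k p ∈ C ↔ p.2 = 0
  subset_range : C ⊆ range k

theorem exists_circleCollar {X : Type*} [TopologicalSpace X] [T2Space X] [LocallyCompactSpace X]
    {C : Set X} (hc : Nonempty (C ≃ₜ Circle)) (hCe : IsLocallyEdge C) {O : Set X} (hO : IsOpen O)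
    (hCO : C ⊆ O) : ∃ k, CircleCollar C k ∧ range k ⊆ O := by
  obtain ⟨φ⟩ := hc
  have hC : IsCompact C := isCompact_iff_compactSpace.2 φ.symm.compactSpace
  obtain ⟨k, hk, hk0, hkO⟩ := exists_collar hC hCe hO hCO
  refine ⟨k ∘ (φ.symm.prodCongr (Homeomorph.refl _)), ⟨?_, ?_, ?_⟩, ?_⟩
  · exact hk.comp (Homeomorph.isOpenEmbedding _)
  · rintro ⟨ζ, s⟩
    change k (φ.symm ζ, s) ∈ C ↔ s = 0
    constructor
    · intro h
      have := hk.injective (hk0 ⟨_, h⟩)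
      exact (congrArg Prod.snd this).symm
    · rintro rfl
      rw [hk0]
      exact (φ.symm ζ).2
  · intro c hc
    exact ⟨(φ ⟨c, hc⟩, 0), by simp [hk0]⟩
  · exact (range_comp_subset_range _ _).trans hkO

theorem CircleCollar.exists_lift {M N : Type*} [TopologicalSpace M] [TopologicalSpace N]
    {C : Set M} {k : Circle × NNReal → M} (hk : CircleCollar C k) {π : M → N}
    (hπ : IsQuotientMap π)
    (hπk : ∀ x ∈ range k, ∀ y, π x = π y ↔ x = y ∨ (x ∈ C ∧ y ∈ C)) :
    ∃ κ : ℂ → N, IsOpenEmbedding κ ∧ ∀ p, κ (polarMap p) = π (k p) := by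
  have hcompat : ∀ p p', polarMap p = polarMap p' ↔ π (k p) = π (k p') := by
    intro p p'
    rw [hπk _ (mem_range_self p), polarMap_eq_iff, hk.mem_iff, hk.mem_iff,
      hk.isOpenEmbedding.injective.eq_iff]
  let g : C(Circle × NNReal, N) := ⟨fun p => π (k p),
    hπ.continuous.comp hk.isOpenEmbedding.continuous⟩
  have hg : Function.FactorsThrough g polarMap := fun p p' h => (hcompat p p').1 h
  let κ := IsQuotientMap.lift (f := (⟨polarMap, continuous_polarMap⟩ : C(_, ℂ)))
    isQuotientMap_polarMap g hg
  have hκ : ∀ p, κ (polarMap p) = π (k p) := fun p => DFunLike.congr_fun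
    (IsQuotientMap.lift_comp (f := (⟨polarMap, continuous_polarMap⟩ : C(_, ℂ)))
      isQuotientMap_polarMap g hg) p
  refine ⟨κ, .of_continuous_injective_isOpenMap κ.continuous ?_ ?_, hκ⟩
  · intro z w h
    obtain ⟨p, rfl⟩ := surjective_polarMap z
    obtain ⟨p', rfl⟩ := surjective_polarMap w
    rw [hκ, hκ] at h
    exact (hcompat p p').2 h
  · intro V hV
    rw [← hπ.isOpen_preimage]
    convert hk.isOpenEmbedding.isOpenMap _ (hV.preimage continuous_polarMap) using 1
    ext x
    constructor
    · rintro ⟨z, hz, h⟩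
      obtain ⟨p, rfl⟩ := surjective_polarMap z
      rw [hκ, hπk _ (mem_range_self p)] at h
      rcases h with rfl | ⟨h, h'⟩
      · exact ⟨p, hz, rfl⟩
      · obtain ⟨p', rfl⟩ := hk.subset_range h'
        rw [hk.mem_iff] at h h'
        refine ⟨p', ?_, rfl⟩
        rwa [mem_preimage, polarMap_eq_iff.2 (.inr ⟨h', h⟩)]
    · rintro ⟨p, hp, rfl⟩
      exact ⟨_, hp, hκ p⟩

theorem isPlanar_collapseMk_iff {M : Type*} [TopologicalSpace M] {C₁ C₂ : Set M}
    {hd : Disjoint C₁ C₂} (hC₁ : IsClosed C₁) (hC₂ : IsClosed C₂) {x : M} (h₁ : x ∉ C₁)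
    (h₂ : x ∉ C₂) : IsPlanar (collapseMk C₁ C₂ hd x) ↔ IsPlanar x := by
  have hx : x ∈ (C₁ ∪ C₂)ᶜ := by simp [h₁, h₂]
  have hO := (hC₁.union hC₂).isOpen_compl
  constructor
  · intro h
    have := isPlanar_of_map (x := (⟨x, hx⟩ : ↥(C₁ ∪ C₂)ᶜ)) (isOpenEmbedding_collapseMk hC₁ hC₂) h
    exact isPlanar_of_isOpenEmbedding hO.isOpenEmbedding_subtypeVal this
  · intro h
    exact isPlanar_of_isOpenEmbedding (isOpenEmbedding_collapseMk hC₁ hC₂) (h.subtype hO hx)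

theorem CircleCollar.isPlanar {M : Type*} [TopologicalSpace M] {C : Set M}
    {k : Circle × NNReal → M} (hk : CircleCollar C k) (hC : IsClosed C) {p : Circle × NNReal}
    (hp : p.2 ≠ 0) : IsPlanar (k p) := by
  have hd : Disjoint C ∅ := disjoint_empty C
  obtain ⟨κ, hκ, hκk⟩ := hk.exists_lift (isQuotientMap_collapseMk (hd := hd)) fun x _ y => by
    simp [collapseMk_eq_iff]
  rw [← isPlanar_collapseMk_iff (hd := hd) hC isClosed_empty (by rwa [hk.mem_iff])
    (notMem_empty _), ← hκk]
  exact isPlanar_of_isOpenEmbedding hκ (isPlanar_complex _)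

/-- There is a disc containing the images of both collapsed boundary circles. -/
theorem exists_disc_collapse {M : Type*} [TopologicalSpace M] [T2Space M] [NormalSpace M]
    [PreconnectedSpace M] (hM : ∀ x : M, IsPlanar x ∨ IsEdge x) {C₁ C₂ : Set M}
    {hd : Disjoint C₁ C₂} (hC₁ : IsClosed C₁) (hC₂ : IsClosed C₂)
    (hp₁ : ∀ x ∈ C₁, ¬ IsPlanar x) (hp₂ : ∀ x ∈ C₂, ¬ IsPlanar x)
    {k₁ k₂ : Circle × NNReal → M} (hk₁ : CircleCollar C₁ k₁) (hk₂ : CircleCollar C₂ k₂)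
    (hkd₁ : Disjoint (range k₁) C₂) (hkd₂ : Disjoint (range k₂) C₁) :
    ∃ a : ℂ → Collapse C₁ C₂ hd, IsOpenEmbedding a ∧
      (∀ x ∈ C₁, a 0 = collapseMk C₁ C₂ hd x) ∧ ∀ x ∈ C₂, a 1 = collapseMk C₁ C₂ hd x := by
  set π := collapseMk C₁ C₂ hd
  have hT2 : T2Space (Collapse C₁ C₂ hd) := t2Space_collapse hC₁ hC₂
  have hπ : IsQuotientMap π := isQuotientMap_collapseMk
  obtain ⟨κ₁, hκ₁, hκk₁⟩ := hk₁.exists_lift hπ fun x hx y => by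
    rw [collapseMk_eq_iff]
    have := disjoint_left.1 hkd₁ hx
    tauto
  obtain ⟨κ₂, hκ₂, hκk₂⟩ := hk₂.exists_lift hπ fun x hx y => by
    rw [collapseMk_eq_iff]
    have := disjoint_left.1 hkd₂ hx
    tauto
  have hplanar : ∀ x : M, x ∉ C₁ → x ∉ C₂ → (IsPlanar (π x) ↔ IsPlanar x) := fun x h₁ h₂ =>
    isPlanar_collapseMk_iff hC₁ hC₂ h₁ h₂
  have hP₁ : IsPlanar (k₁ (1, 1)) := hk₁.isPlanar hC₁ one_ne_zero
  have hP₂ : IsPlanar (k₂ (1, 1)) := hk₂.isPlanar hC₂ one_ne_zero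
  have hp1 : polarMap (1, 1) = 1 := by simp [polarMap]
  have hp0 : polarMap (1, 0) = 0 := by simp [polarMap]
  set P := {x : M | IsPlanar x}
  have hPn : ∀ x ∈ P, x ∉ C₁ ∧ x ∉ C₂ := fun x hx => ⟨fun h => hp₁ x h hx, fun h => hp₂ x h hx⟩
  have hPo : IsOpen (π '' P) := by
    rw [← hπ.isOpen_preimage]
    convert isOpen_isPlanar (X := M) using 1
    ext x
    constructor
    · rintro ⟨y, hy, h⟩
      rw [collapseMk_eq_iff_of_notMem (hPn y hy).1 (hPn y hy).2] at h
      exact h ▸ hy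
    · exact fun hx => ⟨x, hx, rfl⟩
  have hUc : IsPreconnected (π '' P ∪ range κ₂) :=
    IsPreconnected.union (π (k₂ (1, 1))) (mem_image_of_mem _ hP₂) ⟨_, hκk₂ _⟩
      ((isPreconnected_isPlanar hM).image _ hπ.continuous.continuousOn)
      (isPreconnected_range hκ₂.continuous)
  have hUp : ∀ y ∈ π '' P ∪ range κ₂, IsPlanar y := by
    rintro _ (⟨x, hx, rfl⟩ | ⟨z, rfl⟩)
    · exact (hplanar x (hPn x hx).1 (hPn x hx).2).2 hx
    · exact isPlanar_of_isOpenEmbedding hκ₂ (isPlanar_complex _)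
  obtain ⟨Θ, hΘ, K, hKU, -, hK⟩ := exists_homeomorph_map_eq (hPo.union hκ₂.isOpen_range) hUc hUp
    (x := κ₁ 1) (y := κ₂ 0) (.inl ⟨k₁ (1, 1), hP₁, by rw [← hκk₁, hp1]⟩)
    (.inr (mem_range_self _))
  refine ⟨Θ ∘ κ₁, Θ.isOpenEmbedding.comp hκ₁, fun x hx => ?_, fun x hx => ?_⟩
  · have h0 : κ₁ 0 = π x := by
      rw [← hp0, hκk₁, collapseMk_eq_iff]
      exact .inr (.inl ⟨(hk₁.mem_iff _).2 rfl, hx⟩)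
    change Θ (κ₁ 0) = π x
    rw [h0]
    refine hK _ fun h => ?_
    rcases hKU h with ⟨y, hy, h⟩ | ⟨z, h⟩
    · rw [collapseMk_eq_iff_of_notMem (hPn y hy).1 (hPn y hy).2] at h
      exact (hPn y hy).1 (h ▸ hx)
    · obtain ⟨p, rfl⟩ := surjective_polarMap z
      rw [hκk₂, collapseMk_eq_iff] at h
      have h1 := disjoint_left.1 hkd₂ (mem_range_self p)
      have h2 := disjoint_left.1 hd hx
      rcases h with h | h | h
      · exact h1 (h ▸ hx)
      · exact h1 h.1
      · exact h2 h.2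
  · change Θ (κ₁ 1) = π x
    rw [hΘ, ← hp0, hκk₂, collapseMk_eq_iff]
    exact .inr (.inr ⟨(hk₂.mem_iff _).2 rfl, hx⟩)

end

section

theorem exists_ne_zero_eq_on_circles {M : Type*} [TopologicalSpace M] [T2Space M]
    [LocallyCompactSpace M] [SigmaCompactSpace M] [PreconnectedSpace M]
    (hM : ∀ x : M, IsPlanar x ∨ IsEdge x) (hnc : ¬ CompactSpace M) {C₁ C₂ : Set M}
    (hC₂ : IsClosed C₂) (hp₁ : ∀ x ∈ C₁, ¬ IsPlanar x) (hp₂ : ∀ x ∈ C₂, ¬ IsPlanar x)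
    {k : Circle × NNReal → M} (hk : CircleCollar C₂ k) (hkd : Disjoint (range k) C₁) :
    ∃ u : M → ℂ, Continuous u ∧ (∀ x, u x ≠ 0) ∧ (∀ x ∈ C₁, u x = 1) ∧
      ∀ ζ : Circle, u (k (ζ, 0)) = ζ := by
  let l : Circle × NNReal → ℂ := fun p => ((1 - min (p.2 : ℝ) 1 : ℝ) : ℂ) * ((p.1 : ℂ) - 1)
  have hl : Continuous l := by fun_prop
  have hkl : ∀ p, Function.extend k l (fun _ => 0) (k p) = l p :=
    hk.isOpenEmbedding.injective.extend_apply _ _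
  have hv : Continuous fun x => 1 + Function.extend k l (fun _ => 0) x := by
    refine continuous_const.add (hk.isOpenEmbedding.continuous_extend_const hl
      (isCompact_univ.prod (isCompact_Icc (a := 0) (b := 1))) fun p hp => ?_)
    have : 1 < p.2 := by
      by_contra! h
      exact hp ⟨mem_univ _, zero_le, h⟩
    have h1 : min (p.2 : ℝ) 1 = 1 := min_eq_right (by exact_mod_cast this.le)
    simp [l, h1]
  obtain ⟨u, hu, hu0, huv⟩ := exists_push_zero hM hnc hv (q₀ := k (-1, 2⁻¹))
    (hk.isPlanar hC₂ (by simp)) (by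
      intro x hx
      have hxr : x ∈ range k := by
        by_contra h
        rw [Function.extend_apply' _ _ _ (by simpa using h)] at hx
        simp at hx
      obtain ⟨⟨ζ, s⟩, rfl⟩ := hxr
      rw [hkl] at hx
      simp only [l] at hx
      set m : ℝ := min (s : ℝ) 1 with hm
      have hm0 : 0 ≤ m := le_min s.2 zero_le_one
      have hm1 : m ≤ 1 := min_le_right _ _
      have h1 : ((1 - m : ℝ) : ℂ) * ζ = -(m : ℂ) := by
        push_cast at hx ⊢
        linear_combination hx
      have h2 := congrArg norm h1
      rw [norm_mul, Circle.norm_coe, norm_neg, Complex.norm_of_nonneg (by linarith),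
        Complex.norm_of_nonneg hm0, mul_one] at h2
      have h3 : m = 2⁻¹ := by linarith
      have hs : (s : ℝ) = 2⁻¹ := by
        rcases min_choice (s : ℝ) 1 with h | h
        · rw [← h, ← hm, h3]
        · rw [← hm, h3] at h
          norm_num at h
      have hζ : (ζ : ℂ) = -1 := by
        rw [h3] at h1
        push_cast at h1
        linear_combination 2 * h1
      congr 2
      · exact Circle.coe_injective (by simpa using hζ)
      · exact NNReal.coe_injective (by simpa using hs))
  refine ⟨u, hu, hu0, fun x hx => ?_, fun ζ => ?_⟩
  · rw [huv x (hp₁ x hx), Function.extend_apply' _ _ _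
      fun ⟨p, hp⟩ => disjoint_left.1 hkd ⟨p, hp⟩ hx, add_zero]
  · rw [huv _ (hp₂ _ ((hk.mem_iff _).2 rfl)), hkl]
    simp [l]

theorem no_log_unit_circle {G : Circle → ℂ} (hG : Continuous G)
    (h : ∀ ζ : Circle, Complex.exp (G ζ) = ζ) : False := by
  have := eqOn_sub_of_exp_eq (s := (univ : Set ℝ)) (L := fun t => G (Circle.exp t))
    (L' := fun t => t * Complex.I) isPreconnected_univ (by fun_prop) (by fun_prop)
    (fun t _ => by rw [h, Circle.coe_exp]) (mem_univ 0)
    (mem_univ (2 * Real.pi))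
  simp only [Circle.exp_zero, Complex.ofReal_zero, zero_mul, sub_zero, Circle.exp_two_pi] at this
  have h0 : ((2 * Real.pi : ℝ) : ℂ) * Complex.I = 0 := by linear_combination this
  simp at h0

theorem exists_zpow_mul_exp_sub_one {F : ℂ → ℂ} (hF : ContinuousOn F {1}ᶜ)
    (hF0 : ∀ z ≠ 1, F z ≠ 0) :
    ∃ (d : ℤ) (G G' : ℂ → ℂ), ContinuousOn G {1}ᶜ ∧
      (∀ z ≠ 1, F z = (z - 1) ^ d * Complex.exp (G z)) ∧ ContinuousOn G' {z | 1 < ‖z‖} ∧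
      ∀ z, 1 < ‖z‖ → F z = z ^ d * Complex.exp (G' z) := by
  obtain ⟨d, G, hG, hFG⟩ := exists_zpow_mul_exp (fun z => F (z + 1))
    (hF.comp (by fun_prop) fun z hz => by simpa using hz) (fun z hz => hF0 _ (by simpa using hz))
  have hne : ∀ z : ℂ, 1 < ‖z‖ → z ≠ 1 ∧ z ≠ 0 ∧ 1 - z⁻¹ ∈ Complex.slitPlane := by
    intro z hz
    have h0 : z ≠ 0 := by
      rintro rfl
      norm_num at hz
    refine ⟨?_, h0, .inl ?_⟩
    · rintro rfl
      simp at hz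
    · have := Complex.re_le_norm z⁻¹
      have h2 : ‖z⁻¹‖ < 1 := by
        rw [norm_inv]
        exact inv_lt_one_of_one_lt₀ hz
      simp only [Complex.sub_re, Complex.one_re]
      linarith
  have hG1 : ContinuousOn (fun z => G (z - 1)) {1}ᶜ :=
    hG.comp (by fun_prop) fun z hz => by simpa [sub_eq_zero] using hz
  have hFG1 : ∀ z ≠ 1, F z = (z - 1) ^ d * Complex.exp (G (z - 1)) := fun z hz => by
    simpa using hFG (z - 1) (sub_ne_zero.2 hz)
  refine ⟨d, fun z => G (z - 1), fun z => d * Complex.log (1 - z⁻¹) + G (z - 1), hG1, hFG1, ?_, ?_⟩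
  · refine (continuousOn_const.mul (ContinuousOn.clog ?_ fun z hz => (hne z hz).2.2)).add
      (hG1.mono fun z hz => (hne z hz).1)
    exact continuousOn_const.sub (continuousOn_id.inv₀ fun z hz => (hne z hz).2.1)
  · intro z hz
    obtain ⟨h1, h0, hs⟩ := hne z hz
    rw [hFG1 z h1, Complex.exp_add, Complex.exp_int_mul,
      Complex.exp_log (Complex.slitPlane_ne_zero hs), ← mul_assoc, ← mul_zpow]
    congr 3
    field_simp

end

section

/-- If `u` winds once around the circle `C`, its logarithm does not exist near `C`. -/
theorem not_exists_log_near_circle {M N : Type*} [TopologicalSpace M] [TopologicalSpace N]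
    {C : Set M} {k : Circle × NNReal → M} (hk : CircleCollar C k) {u : M → ℂ} (hu : Continuous u)
    (huk : ∀ ζ : Circle, u (k (ζ, 0)) = ζ) {π : M → N} (hπ : Continuous π) {a : ℂ → N}
    (ha : IsOpenEmbedding a) (ha1 : ∀ x, a 1 = π x ↔ x ∈ C) {G : ℂ → ℂ}
    (hG : ContinuousOn G {1}ᶜ) (huG : ∀ x, ∀ z ≠ 1, π x = a z → u x = Complex.exp (G z)) :
    False := by
  obtain ⟨A, B, -, hB, hA, h0B, hAB⟩ := generalized_tube_lemma (s := (univ : Set Circle))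
    isCompact_univ (t := {(0 : NNReal)}) isCompact_singleton
    (n := {p | π (k p) ∈ range a ∧ ‖u (k p) / (p.1 : ℂ) - 1‖ < 1}) (by
      refine IsOpen.inter (ha.isOpen_range.preimage (hπ.comp hk.isOpenEmbedding.continuous)) ?_
      have := hk.isOpenEmbedding.continuous
      refine isOpen_lt (Continuous.norm (Continuous.sub (Continuous.div (by fun_prop) (by fun_prop)
        fun p => Circle.coe_ne_zero _) continuous_const)) continuous_const) (by
      rintro ⟨ζ, s⟩ ⟨-, rfl : s = 0⟩
      refine ⟨⟨1, (ha1 _).2 ((hk.mem_iff _).2 rfl)⟩, ?_⟩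
      simp [huk])
  obtain ⟨s, hs, hs0⟩ : ∃ s ∈ B, s ≠ 0 := by
    have h1 : B ∈ 𝓝 (0 : NNReal) := hB.mem_nhds (h0B rfl)
    have h2 := (mem_nhdsWithin_of_mem_nhds h1 : B ∈ 𝓝[>] (0 : NNReal))
    obtain ⟨s, hs, hs'⟩ := (Filter.nonempty_of_mem (inter_mem h2 self_mem_nhdsWithin))
    exact ⟨s, hs, ne_of_gt hs'⟩
  have hW : ∀ ζ : Circle, π (k (ζ, s)) ∈ range a ∧ ‖u (k (ζ, s)) / (ζ : ℂ) - 1‖ < 1 := fun ζ =>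
    hAB (mk_mem_prod (hA (mem_univ ζ)) hs)
  choose b hb using fun ζ => (hW ζ).1
  have hkc : Continuous fun ζ : Circle => k (ζ, s) :=
    hk.isOpenEmbedding.continuous.comp (by fun_prop)
  have hbc : Continuous b := by
    rw [ha.isEmbedding.continuous_iff, show a ∘ b = _ from funext hb]
    exact hπ.comp hkc
  have hb1 : ∀ ζ, b ζ ≠ 1 := by
    intro ζ h
    have := hb ζ
    rw [h, ha1, hk.mem_iff] at this
    exact hs0 this
  have hsl : ∀ ζ : Circle, u (k (ζ, s)) / (ζ : ℂ) ∈ Complex.slitPlane := by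
    intro ζ
    refine .inl ?_
    have h1 := (hW ζ).2
    have h2 := (abs_le.1 (Complex.abs_re_le_norm (u (k (ζ, s)) / (ζ : ℂ) - 1))).1
    simp only [Complex.sub_re, Complex.one_re] at h2
    linarith
  refine no_log_unit_circle (G := fun ζ => G (b ζ) - Complex.log (u (k (ζ, s)) / (ζ : ℂ))) ?_ ?_
  · refine (hG.comp_continuous hbc hb1).sub (Continuous.clog ?_ hsl)
    exact (hu.comp hkc).div (by fun_prop) fun ζ => Circle.coe_ne_zero _
  · intro ζ
    have h0 := Complex.slitPlane_ne_zero (hsl ζ)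
    rw [Complex.exp_sub, Complex.exp_log h0, ← huG _ _ (hb1 ζ) (hb ζ).symm]
    rw [div_ne_zero_iff] at h0
    have := h0.1
    field_simp

/-- The angle profile of the planar Dehn twist. -/
def twistAngle (z : ℂ) : ℝ := max 0 (min 1 (3 - ‖z‖))

/-- The `c`-th power of the planar Dehn twist supported in the annulus `2 ≤ ‖z‖ ≤ 3`. -/
def planarTwist (c : ℝ) (z : ℂ) : ℂ :=
  z * Complex.exp (2 * Real.pi * Complex.I * (c * twistAngle z : ℝ))

theorem continuous_twistAngle : Continuous twistAngle := by
  unfold twistAngle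
  fun_prop

theorem continuous_planarTwist (c : ℝ) : Continuous (planarTwist c) := by
  have := continuous_twistAngle
  unfold planarTwist
  fun_prop

theorem norm_planarTwist (c : ℝ) (z : ℂ) : ‖planarTwist c z‖ = ‖z‖ := by
  rw [planarTwist, norm_mul, Complex.norm_exp]
  simp

theorem twistAngle_planarTwist (c : ℝ) (z : ℂ) : twistAngle (planarTwist c z) = twistAngle z := by
  rw [twistAngle, norm_planarTwist, twistAngle]

theorem planarTwist_add (c c' : ℝ) (z : ℂ) :
    planarTwist (c + c') z = planarTwist c (planarTwist c' z) := by
  conv_rhs => rw [planarTwist, twistAngle_planarTwist, planarTwist, mul_assoc, ← Complex.exp_add]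
  rw [planarTwist]
  congr 2
  push_cast
  ring

theorem planarTwist_zero (z : ℂ) : planarTwist 0 z = z := by simp [planarTwist]

theorem twistAngle_of_le {z : ℂ} (hz : ‖z‖ ≤ 2) : twistAngle z = 1 := by
  rw [twistAngle, min_eq_left (by linarith), max_eq_right zero_le_one]

theorem twistAngle_of_ge {z : ℂ} (hz : 3 ≤ ‖z‖) : twistAngle z = 0 := by
  rw [twistAngle, max_eq_left]
  exact (min_le_right _ _).trans (by linarith)

theorem planarTwist_of_le (n : ℕ) {z : ℂ} (hz : ‖z‖ ≤ 2) : planarTwist n z = z := by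
  rw [planarTwist, twistAngle_of_le hz, mul_one, mul_comm (2 * _ * _), Complex.ofReal_natCast,
    Complex.exp_nat_mul_two_pi_mul_I, mul_one]

theorem planarTwist_of_ge (c : ℝ) {z : ℂ} (hz : 3 ≤ ‖z‖) : planarTwist c z = z := by
  rw [planarTwist, twistAngle_of_ge hz]
  simp

/-- The Dehn twist along an annulus in a plane with two collapsed points, together with the
lifts of its powers through an invertible function `u`. -/
theorem exists_twist {M N : Type*} [TopologicalSpace M] [T2Space M] [TopologicalSpace N]
    [T2Space N] {π : M → N} (hπ : IsProperMap π) {a : ℂ → N} (ha : IsOpenEmbedding a)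
    {Φ : {z : ℂ // 1 < ‖z‖} → M} (hΦ : IsOpenEmbedding Φ) (hπΦ : ∀ z, π (Φ z) = a z)
    (hinj : ∀ x z, π x = a (z : {z : ℂ // 1 < ‖z‖}) → x = Φ z)
    {u : M → ℂ} {d : ℤ} {G : ℂ → ℂ} (hG : ContinuousOn G {z | 1 < ‖z‖})
    (huG : ∀ z, u (Φ z) = (z : ℂ) ^ d * Complex.exp (G z)) :
    ∃ h ∈ Hc M, ∀ n : ℕ, ∃ L : M → ℂ, Continuous L ∧
      (∀ x, u (hpow h n x) = u x * Complex.exp (L x)) ∧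
      (∀ x, π x = a 0 → L x = 2 * Real.pi * Complex.I * (n * d : ℤ)) ∧
      ∃ K, IsCompact K ∧ ∀ x ∉ K, L x = 0 := by
  let g : ℝ → {z : ℂ // 1 < ‖z‖} → {z : ℂ // 1 < ‖z‖} := fun c z =>
    ⟨planarTwist c z, by rw [norm_planarTwist]; exact z.2⟩
  have hgadd : ∀ c c' z, g (c + c') z = g c (g c' z) := fun c c' z =>
    Subtype.ext (planarTwist_add c c' z)
  have hg0 : ∀ z, g 0 z = z := fun z => Subtype.ext (planarTwist_zero z)
  have hgc : ∀ c, Continuous (g c) := fun c =>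
    ((continuous_planarTwist c).comp continuous_subtype_val).subtype_mk _
  have hgb : Function.Bijective (g 1) := by
    refine Function.bijective_iff_has_inverse.2 ⟨g (-1), fun z => ?_, fun z => ?_⟩
    · rw [← hgadd, neg_add_cancel, hg0]
    · rw [← hgadd, add_neg_cancel, hg0]
  set K₀ : Set {z : ℂ // 1 < ‖z‖} := {z | 2 ≤ ‖(z : ℂ)‖ ∧ ‖(z : ℂ)‖ ≤ 3}
  have hK₀ : IsCompact K₀ := by
    rw [Subtype.isCompact_iff]
    have : ((↑) '' K₀ : Set ℂ) = {z : ℂ | 2 ≤ ‖z‖} ∩ Metric.closedBall 0 3 := by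
      ext z
      constructor
      · rintro ⟨z, hz, rfl⟩
        exact ⟨hz.1, by simpa using hz.2⟩
      · rintro ⟨h, h'⟩
        exact ⟨⟨z, lt_of_lt_of_le one_lt_two h⟩, ⟨h, by simpa using h'⟩, rfl⟩
    rw [this]
    exact (isCompact_closedBall _ _).inter_left (isClosed_le continuous_const continuous_norm)
  have hid : ∀ y ∉ K₀, g 1 y = y := by
    intro y hy
    refine Subtype.ext ?_
    by_cases h : 2 ≤ ‖(y : ℂ)‖
    · exact planarTwist_of_ge 1 (not_le.1 fun h' => hy ⟨h, h'⟩).le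
    · have := planarTwist_of_le 1 (not_le.1 h).le
      rwa [Nat.cast_one] at this
  obtain ⟨h, hh, hhK⟩ := exists_homeomorph_extend hΦ (hgc 1) hgb hK₀ hid
  have hpowΦ : ∀ (n : ℕ) z, hpow h n (Φ z) = Φ (g n z) := by
    intro n z
    induction n with
    | zero => simp [hpow, hg0]
    | succ n ih =>
      change h (hpow h n (Φ z)) = _
      rw [ih, hh, ← hgadd, add_comm, Nat.cast_succ]
  have hpowid : ∀ (n : ℕ), ∀ x ∉ range Φ, hpow h n x = x := by
    intro n x hx
    induction n with
    | zero => rfl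
    | succ n ih =>
      change h (hpow h n x) = _
      rw [ih, hhK x fun hx' => hx (image_subset_range _ _ hx')]
  refine ⟨h, ?_, fun n => ?_⟩
  · refine (hK₀.image hΦ.continuous).closure_of_subset fun x hx => ?_
    by_contra hx'
    exact hx (hhK x hx')
  set ℓ : ℂ → ℂ := fun z => 2 * Real.pi * Complex.I * ((n * d : ℤ) * (twistAngle z : ℝ)) +
    (G (planarTwist n z) - G z) with hℓ
  have hℓ2 : ∀ z, ‖z‖ ≤ 2 → ℓ z = 2 * Real.pi * Complex.I * (n * d : ℤ) := by
    intro z hz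
    simp [hℓ, planarTwist_of_le n hz, twistAngle_of_le hz]
  have hℓc : Continuous ℓ := by
    rw [continuous_iff_continuousAt]
    intro z
    by_cases hz : ‖z‖ < 2
    · refine continuousAt_const.congr (f := fun _ => 2 * Real.pi * Complex.I * (n * d : ℤ)) ?_
      filter_upwards [(isOpen_lt continuous_norm continuous_const).mem_nhds hz] with w hw
      exact (hℓ2 w (le_of_lt hw)).symm
    · have hz1 : 1 < ‖z‖ := by linarith
      have ho : IsOpen {z : ℂ | 1 < ‖z‖} := isOpen_lt continuous_const continuous_norm
      have hta := continuous_twistAngle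
      refine ContinuousAt.add (Continuous.continuousAt (by fun_prop)) (ContinuousAt.sub ?_ ?_)
      · refine ContinuousAt.comp (f := planarTwist n) (g := G) ?_
          (continuous_planarTwist n).continuousAt
        exact hG.continuousAt (ho.mem_nhds (by rw [mem_ofPred_eq, norm_planarTwist]; exact hz1))
      · exact hG.continuousAt (ho.mem_nhds hz1)
  have hℓ0 : ∀ z ∉ Metric.closedBall (0 : ℂ) 3, ℓ z = 0 := by
    intro z hz
    have hz3 : 3 ≤ ‖z‖ := by
      simp only [Metric.mem_closedBall, dist_zero_right, not_le] at hz
      exact hz.le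
    simp [hℓ, planarTwist_of_ge n hz3, twistAngle_of_ge hz3]
  have hext : ∀ z, Function.extend a ℓ (fun _ => 0) (a z) = ℓ z := ha.injective.extend_apply _ _
  have hexp : Complex.exp (2 * Real.pi * Complex.I * (n * d : ℤ)) = 1 := by
    rw [mul_comm, Complex.exp_int_mul_two_pi_mul_I]
  refine ⟨fun x => Function.extend a ℓ (fun _ => 0) (π x), ?_, ?_, ?_, ?_⟩
  · exact (ha.continuous_extend_const hℓc (isCompact_closedBall _ _) hℓ0).comp hπ.continuous
  · intro x
    dsimp only
    by_cases hx : x ∈ range Φ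
    · obtain ⟨z, rfl⟩ := hx
      rw [hpowΦ, hπΦ, hext, huG, huG]
      change planarTwist n z ^ d * Complex.exp (G (planarTwist n z)) = _
      have h1 : planarTwist n z ^ d = (z : ℂ) ^ d *
          Complex.exp (2 * Real.pi * Complex.I * ((n * d : ℤ) * (twistAngle z : ℝ))) := by
        rw [planarTwist, mul_zpow, ← Complex.exp_int_mul]
        congr 2
        push_cast
        ring
      rw [h1, hℓ]
      dsimp only
      rw [Complex.exp_add, Complex.exp_sub]
      have := Complex.exp_ne_zero (G z)
      field_simp
    · rw [hpowid n x hx]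
      by_cases hxa : ∃ z, a z = π x
      · obtain ⟨z, hz⟩ := hxa
        have hz1 : ‖z‖ ≤ 1 := by
          by_contra! hz1
          exact hx ⟨⟨z, hz1⟩, (hinj x ⟨z, hz1⟩ hz.symm).symm⟩
        rw [← hz, hext, hℓ2 z (by linarith), hexp, mul_one]
      · rw [Function.extend_apply' _ _ _ hxa, Complex.exp_zero, mul_one]
  · intro x hx
    dsimp only
    rw [hx, hext, hℓ2 0 (by simp)]
  · refine ⟨π ⁻¹' (a '' Metric.closedBall 0 3), hπ.isCompact_preimage
      ((isCompact_closedBall _ _).image ha.continuous), fun x hx => ?_⟩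
    dsimp only
    by_cases hxa : ∃ z, a z = π x
    · obtain ⟨z, hz⟩ := hxa
      rw [← hz, hext]
      exact hℓ0 z fun h => hx ⟨z, h, hz⟩
    · rw [Function.extend_apply' _ _ _ hxa]

end

section

theorem exists_twist_of_circleCollar {M : Type*} [TopologicalSpace M] [T2Space M]
    [LocallyCompactSpace M] [SigmaCompactSpace M] [PreconnectedSpace M]
    (hM : ∀ x : M, IsPlanar x ∨ IsEdge x) (hnc : ¬ CompactSpace M) {C₁ C₂ : Set M}
    (hd : Disjoint C₁ C₂) (hC₁ : IsCompact C₁) (hC₂ : IsCompact C₂)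
    (hp₁ : ∀ x ∈ C₁, ¬ IsPlanar x) (hp₂ : ∀ x ∈ C₂, ¬ IsPlanar x)
    {k₁ k₂ : Circle × NNReal → M} (hk₁ : CircleCollar C₁ k₁) (hk₂ : CircleCollar C₂ k₂)
    (hkd₁ : Disjoint (range k₁) C₂) (hkd₂ : Disjoint (range k₂) C₁) :
    ∃ u : M → ℂ, Continuous u ∧ (∀ x, u x ≠ 0) ∧ (∀ x ∈ C₁, u x = 1) ∧
      ∃ h ∈ Hc M, ∃ d : ℤ, d ≠ 0 ∧ ∀ n : ℕ, ∃ L : M → ℂ, Continuous L ∧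
        (∀ x, u (hpow h n x) = u x * Complex.exp (L x)) ∧
        (∀ x ∈ C₁, L x = 2 * Real.pi * Complex.I * (n * d : ℤ)) ∧
        ∃ K, IsCompact K ∧ ∀ x ∉ K, L x = 0 := by
  obtain ⟨u, hu, hu0, hu₁, huk⟩ :=
    exists_ne_zero_eq_on_circles hM hnc hC₂.isClosed hp₁ hp₂ hk₂ hkd₂
  obtain ⟨a, ha, ha0, ha1⟩ := exists_disc_collapse (hd := hd) hM hC₁.isClosed hC₂.isClosed hp₁ hp₂
    hk₁ hk₂ hkd₁ hkd₂
  have hT2 : T2Space (Collapse C₁ C₂ hd) := t2Space_collapse hC₁.isClosed hC₂.isClosed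
  obtain ⟨c₁, hc₁⟩ : C₁.Nonempty := ⟨_, (hk₁.mem_iff (1, 0)).2 rfl⟩
  obtain ⟨c₂, hc₂⟩ : C₂.Nonempty := ⟨_, (hk₂.mem_iff (1, 0)).2 rfl⟩
  have hdj : ∀ x ∈ C₁, x ∉ C₂ := fun x h => disjoint_left.1 hd h
  have hπ : IsProperMap (collapseMk C₁ C₂ hd) := isProperMap_collapseMk hC₁ hC₂
  have hπ0 : ∀ x, a 0 = collapseMk C₁ C₂ hd x ↔ x ∈ C₁ := by
    refine fun x => ⟨fun h => ?_, ha0 x⟩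
    rw [ha0 c₁ hc₁, collapseMk_eq_iff] at h
    have := hdj c₁ hc₁
    rcases h with rfl | h | h
    · exact hc₁
    · exact h.2
    · exact absurd h.1 this
  have hπ1 : ∀ x, a 1 = collapseMk C₁ C₂ hd x ↔ x ∈ C₂ := by
    refine fun x => ⟨fun h => ?_, ha1 x⟩
    rw [ha1 c₂ hc₂, collapseMk_eq_iff] at h
    have := fun h => hdj c₂ h hc₂
    rcases h with rfl | h | h
    · exact hc₂
    · exact absurd h.1 this
    · exact h.2
  classical
  let U : Collapse C₁ C₂ hd → ℂ := Quotient.lift (fun x => if x ∈ C₂ then 1 else u x) (by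
    rintro x y (rfl | ⟨hx, hy⟩ | ⟨hx, hy⟩)
    · rfl
    · simp [hdj x hx, hdj y hy, hu₁ x hx, hu₁ y hy]
    · simp [hx, hy])
  have hU : ∀ x ∉ C₂, U (collapseMk C₁ C₂ hd x) = u x := fun x hx => if_neg hx
  have hUc : ContinuousOn U {a 1}ᶜ := by
    rw [isQuotientMap_collapseMk.continuousOn_isOpen_iff isOpen_compl_singleton]
    refine hu.continuousOn.congr fun x hx => hU x fun h => hx ?_
    exact ((hπ1 x).2 h).symm
  obtain ⟨d, G, G', hG, hFG, hG', hFG'⟩ := exists_zpow_mul_exp_sub_one (F := U ∘ a)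
    (hUc.comp ha.continuous.continuousOn fun z hz h => hz (ha.injective h)) (by
      intro z hz
      obtain ⟨x, hx⟩ := surjective_collapseMk (a z)
      have hxC : x ∉ C₂ := fun h => hz (ha.injective (hx.symm.trans ((hπ1 x).2 h).symm))
      rw [Function.comp_apply, ← hx, hU x hxC]
      exact hu0 x)
  have hUa : ∀ x z, z ≠ 1 → collapseMk C₁ C₂ hd x = a z → U (a z) = u x := by
    intro x z hz hx
    rw [← hx, hU]
    exact fun h => hz (ha.injective (hx.symm.trans ((hπ1 x).2 h).symm))
  have hd0 : d ≠ 0 := by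
    rintro rfl
    refine not_exists_log_near_circle hk₂ hu huk hπ.continuous ha hπ1 hG fun x z hz hx => ?_
    rw [← hUa x z hz hx]
    simpa using hFG z hz
  have hY : ∀ z : {z : ℂ // 1 < ‖z‖}, ∃ x : ↥(C₁ ∪ C₂)ᶜ, collapseMk C₁ C₂ hd x = a z := by
    rintro ⟨z, hz⟩
    obtain ⟨x, hx⟩ := surjective_collapseMk (a z)
    refine ⟨⟨x, ?_⟩, hx⟩
    rintro (h | h)
    · have := ha.injective (hx.symm.trans ((hπ0 x).2 h).symm)
      norm_num [this] at hz
    · have := ha.injective (hx.symm.trans ((hπ1 x).2 h).symm)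
      norm_num [this] at hz
  choose Ψ hΨ using hY
  have hYo : IsOpen {z : ℂ | 1 < ‖z‖} := isOpen_lt continuous_const continuous_norm
  have hΨe : IsOpenEmbedding Ψ := by
    refine .of_comp _ (isOpenEmbedding_collapseMk (hd := hd) hC₁.isClosed hC₂.isClosed) ?_
    have h : (fun x : ↥(C₁ ∪ C₂)ᶜ => collapseMk C₁ C₂ hd x) ∘ Ψ = a ∘ Subtype.val := funext hΨ
    rw [h]
    exact ha.comp hYo.isOpenEmbedding_subtypeVal
  have hCo : IsOpen (C₁ ∪ C₂)ᶜ := (hC₁.isClosed.union hC₂.isClosed).isOpen_compl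
  have hY1 : ∀ z : {z : ℂ // 1 < ‖z‖}, (z : ℂ) ≠ 1 := by
    rintro ⟨z, hz⟩ rfl
    norm_num at hz
  obtain ⟨h, hh, hL⟩ := exists_twist (Φ := fun z => (Ψ z : M)) hπ ha
    (hCo.isOpenEmbedding_subtypeVal.comp hΨe) hΨ (fun x z hx => by
      have hz : (Ψ z : M) ∉ C₁ ∪ C₂ := (Ψ z).2
      rw [mem_union, not_or] at hz
      rw [← hΨ, eq_comm, collapseMk_eq_iff_of_notMem hz.1 hz.2] at hx
      exact hx.symm) (u := u) hG' (fun z => by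
      rw [← hUa _ _ (hY1 z) (hΨ z)]
      exact hFG' z z.2)
  refine ⟨u, hu, hu0, hu₁, h, hh, d, hd0, fun n => ?_⟩
  obtain ⟨L, hLc, hLu, hL0, hLK⟩ := hL n
  exact ⟨L, hLc, hLu, fun x hx => hL0 x ((hπ0 x).2 hx).symm, hLK⟩

theorem IsLocallyEdge.exists_isOpen {M : Type*} [TopologicalSpace M] {C : Set M}
    (hC : IsLocallyEdge C) : ∃ O, IsOpen O ∧ C ⊆ O ∧ ∀ x ∈ O, ¬ IsPlanar x → x ∈ C := by
  choose! e he he0 heC using hC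
  refine ⟨⋃ c ∈ C, range (e c), isOpen_biUnion fun c hc => (he c hc).isOpen_range,
    fun c hc => mem_biUnion hc ⟨_, he0 c hc⟩, fun x hx hxp => ?_⟩
  simp only [mem_iUnion] at hx
  obtain ⟨c, hc, p, rfl⟩ := hx
  rw [isPlanar_iff_of_edge (he c hc)] at hxp
  exact (heC c hc p).2 (by simpa using hxp)

theorem exists_pos_tendsto_cocompact (M : Type*) [TopologicalSpace M] [T2Space M]
    [LocallyCompactSpace M] [SigmaCompactSpace M] :
    ∃ ε : M → ℝ, Continuous ε ∧ (∀ x, 0 < ε x ∧ ε x ≤ 1) ∧ Tendsto ε (cocompact M) (𝓝 0) := by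
  let K : CompactExhaustion M := default
  obtain ⟨ε, hε⟩ := exists_continuous_forall_mem_convex_of_local_const
    (t := fun x => Ioc (0 : ℝ) (1 / (K.find x + 1))) (fun x => convex_Ioc _ _) (fun x => by
      refine ⟨1 / (K.find x + 1 + 1), ?_⟩
      have hx : x ∈ interior (K (K.find x + 1)) := K.subset_interior_succ _ (K.mem_find x)
      filter_upwards [isOpen_interior.mem_nhds hx] with y hy
      refine ⟨by positivity, ?_⟩
      have : K.find y ≤ K.find x + 1 := K.mem_iff_find_le.1 (interior_subset hy)
      have h2 : (K.find y : ℝ) ≤ K.find x + 1 := by exact_mod_cast this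
      exact one_div_le_one_div_of_le (by positivity) (by linarith))
  refine ⟨ε, ε.continuous, fun x => ⟨(hε x).1, (hε x).2.trans ?_⟩, ?_⟩
  · rw [div_le_one (by positivity)]
    linarith [(K.find x).cast_nonneg (α := ℝ)]
  · rw [Metric.tendsto_nhds]
    intro δ hδ
    obtain ⟨n, hn⟩ := exists_nat_one_div_lt hδ
    filter_upwards [(K.isCompact n).compl_mem_cocompact] with x hx
    have h1 : n < K.find x := by
      by_contra! h
      exact hx (K.mem_iff_find_le.2 h)
    have h2 : (n : ℝ) ≤ K.find x := by exact_mod_cast h1.le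
    rw [Real.dist_eq, sub_zero, abs_of_pos (hε x).1]
    refine ((hε x).2.trans ?_).trans_lt hn
    exact one_div_le_one_div_of_le (by positivity) (by linarith)

theorem isOpen_graph_subset {M : Type*} [TopologicalSpace M] {U : Set (M × M)} (hU : IsOpen U) :
    IsOpen {f : M ≃ₜ M | ∀ x, (x, f x) ∈ U} :=
  TopologicalSpace.isOpen_generateFrom_of_mem ⟨U, hU, rfl⟩

/-- Homeomorphisms `f` preserving `C` for which `u ∘ f / u` has a logarithm that vanishes at the
base point and at infinity. -/
def relLogSet {M : Type*} [TopologicalSpace M] (u : M → ℂ) (C : Set M) (x₀ : M) : Set (M ≃ₜ M) :=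
  {f | f x₀ ∈ C ∧ ∃ L : M → ℂ, Continuous L ∧ (∀ x, u (f x) = u x * Complex.exp (L x)) ∧
    L x₀ = 0 ∧ Tendsto L (cocompact M) (𝓝 0)}

theorem mem_relLogSet_of_close {M : Type*} [TopologicalSpace M] {u : M → ℂ} (hu : Continuous u)
    (hu0 : ∀ x, u x ≠ 0) {C : Set M} (huC : ∀ x ∈ C, u x = 1) {x₀ : M} {ε : M → ℝ}
    (hε1 : ∀ x, ε x ≤ 1) (hε : Tendsto ε (cocompact M) (𝓝 0)) {f g : M ≃ₜ M}
    (hgC : g x₀ ∈ C) (hfg : ∀ x, ‖u (g x) / u (f x) - 1‖ < ε x) (hf : f ∈ relLogSet u C x₀) :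
    g ∈ relLogSet u C x₀ := by
  obtain ⟨hfC, L, hLc, hLu, hL0, hLt⟩ := hf
  set m : M → ℂ := fun x => u (g x) / u (f x) with hm
  have hmc : Continuous m := (hu.comp g.continuous).div (hu.comp f.continuous) fun x => hu0 _
  have hsl : ∀ x, m x ∈ Complex.slitPlane := by
    intro x
    refine .inl ?_
    have h1 := (hfg x).trans_le (hε1 x)
    have h2 := (abs_le.1 (Complex.abs_re_le_norm (m x - 1))).1
    simp only [Complex.sub_re, Complex.one_re] at h2
    change ‖m x - 1‖ < 1 at h1
    linarith
  have hmt : Tendsto m (cocompact M) (𝓝 1) := by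
    rw [tendsto_iff_norm_sub_tendsto_zero]
    exact squeeze_zero (fun x => norm_nonneg _) (fun x => (hfg x).le) hε
  refine ⟨hgC, fun x => L x + Complex.log (m x), hLc.add (hmc.clog hsl), fun x => ?_, ?_, ?_⟩
  · rw [Complex.exp_add, ← mul_assoc, ← hLu, Complex.exp_log (Complex.slitPlane_ne_zero (hsl x)),
      hm, mul_div_cancel₀ _ (hu0 _)]
  · simp [hm, hL0, huC _ hfC, huC _ hgC]
  · have := hLt.add (hmt.clog Complex.one_mem_slitPlane)
    simpa using this

theorem isClopen_relLogSet {M : Type*} [TopologicalSpace M] [T2Space M]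
    [LocallyCompactSpace M] [SigmaCompactSpace M] {u : M → ℂ} (hu : Continuous u)
    (hu0 : ∀ x, u x ≠ 0) {C : Set M} (hC : IsClosed C) (hCe : IsLocallyEdge C)
    (huC : ∀ x ∈ C, u x = 1) {x₀ : M} (hx₀ : ¬ IsPlanar x₀) : IsClopen (relLogSet u C x₀) := by
  obtain ⟨ε, hεc, hε0, hεt⟩ := exists_pos_tendsto_cocompact M
  obtain ⟨O, hO, hCO, hOC⟩ := hCe.exists_isOpen
  have hev : ∀ O : Set M, IsOpen O → IsOpen {g : M ≃ₜ M | g x₀ ∈ O} := by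
    intro O hO
    convert isOpen_graph_subset (U := {p : M × M | p.1 ≠ x₀ ∨ p.2 ∈ O})
      ((isOpen_compl_singleton.preimage continuous_fst).union (hO.preimage continuous_snd)) using 1
    ext g
    constructor
    · intro h x
      by_cases hx : x = x₀
      · exact .inr (hx ▸ h)
      · exact .inl hx
    · exact fun h => (h x₀).resolve_left fun h => h rfl
  have hgC : ∀ g : M ≃ₜ M, g x₀ ∈ O → g x₀ ∈ C := fun g h =>
    hOC _ h (by rwa [isPlanar_homeomorph])
  have hnhd : ∀ f : M ≃ₜ M, f x₀ ∈ C → ∀ᶠ g in 𝓝 f, g x₀ ∈ C ∧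
      ∀ x, ‖u (g x) / u (f x) - 1‖ < ε x ∧ ‖u (f x) / u (g x) - 1‖ < ε x := by
    intro f hf
    have hU : IsOpen {p : M × M | ‖u p.2 / u (f p.1) - 1‖ < ε p.1 ∧
        ‖u (f p.1) / u p.2 - 1‖ < ε p.1} := by
      have h₁ : Continuous fun p : M × M => u p.2 / u (f p.1) :=
        (hu.comp continuous_snd).div (hu.comp (f.continuous.comp continuous_fst)) fun _ => hu0 _
      have h₂ : Continuous fun p : M × M => u (f p.1) / u p.2 :=
        (hu.comp (f.continuous.comp continuous_fst)).div (hu.comp continuous_snd) fun _ => hu0 _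
      have h₃ : Continuous fun p : M × M => ε p.1 := hεc.comp continuous_fst
      exact (isOpen_lt (h₁.sub continuous_const).norm h₃).inter
        (isOpen_lt (h₂.sub continuous_const).norm h₃)
    filter_upwards [(hev O hO).mem_nhds (hCO hf), (isOpen_graph_subset hU).mem_nhds (x := f)
      fun x => by simp [hu0, (hε0 x).1]] with g hg hg'
    exact ⟨hgC g hg, hg'⟩
  constructor
  · rw [← isOpen_compl_iff, isOpen_iff_mem_nhds]
    intro f hf
    by_cases hfC : f x₀ ∈ C
    · filter_upwards [hnhd f hfC] with g hg hgQ
      exact hf (mem_relLogSet_of_close hu hu0 huC (fun x => (hε0 x).2) hεt hfC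
        (fun x => (hg.2 x).2) hgQ)
    · filter_upwards [(hev Cᶜ hC.isOpen_compl).mem_nhds hfC] with g hg hgQ
      exact hg hgQ.1
  · rw [isOpen_iff_mem_nhds]
    intro f hf
    filter_upwards [hnhd f hf.1] with g hg
    exact mem_relLogSet_of_close hu hu0 huC (fun x => (hε0 x).2) hεt hg.1 (fun x => (hg.2 x).1) hf

theorem exists_infinite_order_of_circles {M : Type*} [TopologicalSpace M] [T2Space M]
    [LocallyCompactSpace M] [SigmaCompactSpace M] [ConnectedSpace M]
    (hM : ∀ x : M, IsPlanar x ∨ IsEdge x) (hnc : ¬ CompactSpace M) {C₁ C₂ : Set M}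
    (hd : Disjoint C₁ C₂) (hp₁ : ∀ x ∈ C₁, ¬ IsPlanar x) (hp₂ : ∀ x ∈ C₂, ¬ IsPlanar x)
    (he₁ : IsLocallyEdge C₁) (he₂ : IsLocallyEdge C₂) (hc₁ : Nonempty (C₁ ≃ₜ Circle))
    (hc₂ : Nonempty (C₂ ≃ₜ Circle)) :
    ∃ h ∈ Hc M, ∀ n : ℕ, 0 < n → hpow h n ∉ H0 M := by
  have hC₁ : IsCompact C₁ := isCompact_iff_compactSpace.2 hc₁.some.symm.compactSpace
  have hC₂ : IsCompact C₂ := isCompact_iff_compactSpace.2 hc₂.some.symm.compactSpace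
  obtain ⟨k₁, hk₁, hkr₁⟩ := exists_circleCollar hc₁ he₁ hC₂.isClosed.isOpen_compl
    hd.subset_compl_right
  obtain ⟨k₂, hk₂, hkr₂⟩ := exists_circleCollar hc₂ he₂ hC₁.isClosed.isOpen_compl
    hd.symm.subset_compl_right
  obtain ⟨u, hu, hu0, hu₁, h, hh, d, hd0, hL⟩ := exists_twist_of_circleCollar hM hnc hd hC₁ hC₂
    hp₁ hp₂ hk₁ hk₂ (disjoint_left.2 fun x hx => hkr₁ hx) (disjoint_left.2 fun x hx => hkr₂ hx)
  refine ⟨h, hh, fun n hn hH => ?_⟩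
  set x₀ := k₁ (1, 0)
  have hx₀ : x₀ ∈ C₁ := (hk₁.mem_iff _).2 rfl
  have hQ := (isClopen_relLogSet hu hu0 hC₁.isClosed he₁ hu₁ (hp₁ x₀ hx₀)).connectedComponent_subset
    (x := Homeomorph.refl M) ⟨hx₀, fun _ => 0, continuous_const, fun x => by simp, rfl,
      tendsto_const_nhds⟩ hH
  obtain ⟨-, L', hL'c, hL'u, hL'0, hL't⟩ := hQ
  obtain ⟨L, hLc, hLu, hL0, K, hK, hLK⟩ := hL n
  have hconst : ∀ x, L x = L x₀ - L' x₀ + L' x := fun x => by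
    have := eqOn_sub_of_exp_eq (s := (univ : Set M)) isPreconnected_univ hLc.continuousOn
      hL'c.continuousOn (fun x _ => mul_left_cancel₀ (hu0 x) ((hLu x).symm.trans (hL'u x)))
      (mem_univ x) (mem_univ x₀)
    linear_combination this
  have hNC : NoncompactSpace M := not_compactSpace_iff.1 hnc
  have h1 : Tendsto L (cocompact M) (𝓝 0) := by
    refine tendsto_const_nhds.congr' ?_
    filter_upwards [hK.compl_mem_cocompact] with x hx
    exact (hLK x hx).symm
  have h2 : Tendsto L (cocompact M) (𝓝 (L x₀ - L' x₀ + 0)) := by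
    exact (tendsto_const_nhds.add hL't).congr fun x => (hconst x).symm
  have h3 := tendsto_nhds_unique h1 h2
  rw [hL'0, hL0 x₀ hx₀, sub_zero, add_zero] at h3
  have h4 : ((n * d : ℤ) : ℂ) ≠ 0 := by
    exact_mod_cast mul_ne_zero (by exact_mod_cast hn.ne') hd0
  exact mul_ne_zero Complex.two_pi_I_ne_zero h4 h3.symm

theorem nonempty_homeomorph_circle : Nonempty (Circle2 ≃ₜ Circle) := by
  let e := Complex.orthonormalBasisOneI.repr
  have he : ∀ x : ℂ, x ∈ Submonoid.unitSphere ℂ ↔ e x ∈ Metric.sphere 0 1 := fun x => by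
    simp [Submonoid.unitSphere]
  exact ⟨(e.toHomeomorph.subtype he).symm⟩

end

end

variable (M : Type*) [TopologicalSpace M] [T2Space M] [SigmaCompactSpace M]
  [ChartedSpace (EuclideanHalfSpace 2) M] [ConnectedSpace M]

/-- If the boundary of a σ-compact non-compact connected 2-manifold `M` has two distinct
connected components homeomorphic to the circle, then the mapping class group
`𝓜_c(M) = 𝓗_c(M)/𝓗₀(M)` contains an element of infinite order. -/
theorem mcg_infinite_order_of_two_boundary_circles (hnc : ¬ CompactSpace M)
    (C₁ C₂ : Set M)
    (hC₁ : ∃ x ∈ surfaceBoundary M, C₁ = connectedComponentIn (surfaceBoundary M) x)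
    (hC₂ : ∃ x ∈ surfaceBoundary M, C₂ = connectedComponentIn (surfaceBoundary M) x)
    (hne : C₁ ≠ C₂)
    (hcirc₁ : Nonempty (↥C₁ ≃ₜ Circle2)) (hcirc₂ : Nonempty (↥C₂ ≃ₜ Circle2)) :
    ∃ h ∈ Hc M, ∀ n : ℕ, 0 < n → hpow h n ∉ H0 M := by
  obtain ⟨x₁, -, h₁⟩ := hC₁
  obtain ⟨x₂, -, h₂⟩ := hC₂
  obtain ⟨φ⟩ := nonempty_homeomorph_circle
  have := Manifold.locallyCompact_of_finiteDimensional (M := M) (modelWithCornersEuclideanHalfSpace 2)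
  have hM : ∀ x : M, IsPlanar x ∨ IsEdge x := isPlanar_or_isEdge
  rw [surfaceBoundary_eq] at h₁ h₂
  refine exists_infinite_order_of_circles hM hnc (C₁ := C₁) (C₂ := C₂) ?_ ?_ ?_ ?_ ?_
    (hcirc₁.map fun ψ => ψ.trans φ) (hcirc₂.map fun ψ => ψ.trans φ)
  · rw [Set.disjoint_left]
    intro x hx₁ hx₂
    rw [h₁] at hx₁
    rw [h₂] at hx₂
    exact hne (h₁.trans ((connectedComponentIn_eq hx₁).trans
      ((connectedComponentIn_eq hx₂).symm.trans h₂.symm)))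
  · exact h₁ ▸ connectedComponentIn_subset _ _
  · exact h₂ ▸ connectedComponentIn_subset _ _
  · exact h₁ ▸ isLocallyEdge_component hM _
  · exact h₂ ▸ isLocallyEdge_component hM _
end
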